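/- Let T be a compactly generated R-linear triangulated category that is noetherian and stratified by R. Then for each pair of compact objects C, D of T there is an equality supp_R Hom*_T(C,D) = supp_R C ∩ supp_R D. If in addition R^i = 0 for all i < 0, then Hom^n_T(C,D) = 0 for all n ≫ 0 if and only if Hom^n_T(D,C) = 0 for all n ≫ 0. -/

import Mathlib

open CategoryTheory CategoryTheory.Limits CategoryTheory.Pretriangulated

universe w v u u'

namespace BIK

section RingDefs

variable {R : Type u} [Ring R] (𝒜 : ℤ → AddSubgroup R) [GradedRing 𝒜]

/-- `R` is graded-commutative: `a * b = (-1)^{|a||b|} b * a` for homogeneous `a`, `b`. -/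
def IsGradedComm : Prop :=
  ∀ (i j : ℤ) (a b : R), a ∈ 𝒜 i → b ∈ 𝒜 j →
    a * b = ((-1 : ℤ) ^ (i * j).natAbs) • (b * a)

/-- A homogeneous ideal is prime if it is proper and for homogeneous elements `a`, `b`,
`a * b ∈ P` implies `a ∈ P` or `b ∈ P`. -/
structure IsHomPrime (P : HomogeneousIdeal 𝒜) : Prop where
  ne_top : P.toIdeal ≠ ⊤
  mem_or_mem : ∀ {i j : ℤ} {a b : R}, a ∈ 𝒜 i → b ∈ 𝒜 j →
    a * b ∈ P.toIdeal → a ∈ P.toIdeal ∨ b ∈ P.toIdeal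

/-- `Spec R`: the set of homogeneous prime ideals of the graded ring `R`. -/
def SpecR : Type u := {P : HomogeneousIdeal 𝒜 // IsHomPrime 𝒜 P}

variable {𝒜}

/-- `V(𝔞)`, the set of homogeneous primes containing the ideal `𝔞`. -/
def specV (𝔞 : Ideal R) : Set (SpecR 𝒜) := {p | 𝔞 ≤ p.1.toIdeal}

/-- A subset of `Spec R` is specialization closed if with any point it contains all larger
primes. -/
def SpecClosed (V : Set (SpecR 𝒜)) : Prop :=
  ∀ p q : SpecR 𝒜, p ∈ V → p.1.toIdeal ≤ q.1.toIdeal → q ∈ V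

/-- `Z(p) = { q | q ⊄ p }`. -/
def Zset (p : SpecR 𝒜) : Set (SpecR 𝒜) := {q | ¬ q.1.toIdeal ≤ p.1.toIdeal}

/-- `V(p) = { q | q ⊇ p }`. -/
def Vp (p : SpecR 𝒜) : Set (SpecR 𝒜) := {q | p.1.toIdeal ≤ q.1.toIdeal}

/-- The specialization closure of a subset of `Spec R`. -/
def specCl (U : Set (SpecR 𝒜)) : Set (SpecR 𝒜) := {p | ∃ q ∈ U, q.1.toIdeal ≤ p.1.toIdeal}

/-- The subset `U ⊆ Spec R` has finite dimension: the lengths of strict chains of primes in `U`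
are bounded. -/
def FiniteDim (U : Set (SpecR 𝒜)) : Prop :=
  ∃ n : ℕ, ∀ (m : ℕ) (c : Fin (m + 1) → SpecR 𝒜), (∀ i, c i ∈ U) →
    (StrictMono fun i => (c i).1.toIdeal) → m ≤ n

end RingDefs

section CatDefs

variable (T : Type u') [Category.{v} T] [HasZeroObject T] [Preadditive T] [HasShift T ℤ]
  [∀ n : ℤ, (CategoryTheory.shiftFunctor T n).Additive] [Pretriangulated T]
  [HasCoproducts.{v} T]

/-- The canonical map `⨁ⱼ Hom(C, fⱼ) → Hom(C, ∐ f)`. -/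
noncomputable def sigmaHom (C : T) {J : Type v} (f : J → T) :
    (DirectSum J fun j => (C ⟶ f j)) →+ (C ⟶ ∐ f) :=
  letI := Classical.decEq J
  DirectSum.toAddMonoid fun j =>
    AddMonoidHom.mk' (fun g => g ≫ Sigma.ι f j) (fun g h => by simp)

/-- An object `C` is compact if `Hom(C, -)` commutes with arbitrary coproducts. -/
def IsCompactObj (C : T) : Prop :=
  ∀ (J : Type v) (f : J → T), Function.Bijective (sigmaHom T C f)

/-- A localizing subcategory: a (strictly full) triangulated subcategory closed under
arbitrary coproducts. -/
structure IsLocalizing (S : Set T) : Prop where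
  zero_mem : ∀ X : T, Limits.IsZero X → X ∈ S
  iso_mem : ∀ {X Y : T}, (X ≅ Y) → X ∈ S → Y ∈ S
  shift_mem : ∀ X ∈ S, ∀ n : ℤ, X⟦n⟧ ∈ S
  ext_mem : ∀ Tr ∈ distTriang T, Tr.obj₁ ∈ S → Tr.obj₂ ∈ S → Tr.obj₃ ∈ S
  coprod_mem : ∀ (J : Type v) (f : J → T), (∀ j, f j ∈ S) → (∐ f) ∈ S

/-- The localizing subcategory generated by a class of objects. -/
def Loc (A : Set T) : Set T := ⋂₀ {S | IsLocalizing T S ∧ A ⊆ S}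

/-- A thick subcategory: a (strictly full) triangulated subcategory closed under
direct summands (i.e. retracts). -/
structure IsThick (S : Set T) : Prop where
  zero_mem : ∀ X : T, Limits.IsZero X → X ∈ S
  iso_mem : ∀ {X Y : T}, (X ≅ Y) → X ∈ S → Y ∈ S
  shift_mem : ∀ X ∈ S, ∀ n : ℤ, X⟦n⟧ ∈ S
  ext_mem : ∀ Tr ∈ distTriang T, Tr.obj₁ ∈ S → Tr.obj₂ ∈ S → Tr.obj₃ ∈ S
  retract_mem : ∀ X Y : T, Y ∈ S → ∀ (i : X ⟶ Y) (p : Y ⟶ X), i ≫ p = 𝟙 X → X ∈ S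

/-- The thick subcategory generated by a class of objects. -/
def ThickSub (A : Set T) : Set T := ⋂₀ {S | IsThick T S ∧ A ⊆ S}

/-- `T` is compactly generated: it is generated, as a localizing subcategory,
by a set of compact objects. -/
def CompactlyGen : Prop :=
  ∃ (ι : Type v) (g : ι → T), (∀ i, IsCompactObj T (g i)) ∧ Loc T (Set.range g) = Set.univ

end CatDefs

section Action

variable {R : Type u} [Ring R] (𝒜 : ℤ → AddSubgroup R) [GradedRing 𝒜]
variable (T : Type u') [Category.{v} T] [HasZeroObject T] [Preadditive T] [HasShift T ℤ]
  [∀ n : ℤ, (CategoryTheory.shiftFunctor T n).Additive] [Pretriangulated T]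
  [HasCoproducts.{v} T]

/-- An action of the graded ring `R` on the triangulated category `T`, i.e. a homomorphism of
graded rings from `R` to the graded center of `T`: each homogeneous `a ∈ R` of degree `i`
determines a natural transformation `Id → Σⁱ` commuting with the shift up to the sign
`(-1)^i`. -/
structure CenterAction where
  act : ∀ (i : ℤ) (a : R), a ∈ 𝒜 i → ∀ X : T, X ⟶ X⟦i⟧
  act_add : ∀ (i : ℤ) (a b : R) (ha : a ∈ 𝒜 i) (hb : b ∈ 𝒜 i) (X : T),
    act i (a + b) (add_mem ha hb) X = act i a ha X + act i b hb X
  act_one : ∀ X : T, act 0 1 (SetLike.one_mem_graded 𝒜) X = (shiftFunctorZero T ℤ).inv.app X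
  act_mul : ∀ (i j : ℤ) (a b : R) (ha : a ∈ 𝒜 i) (hb : b ∈ 𝒜 j) (X : T),
    act (i + j) (a * b) (SetLike.mul_mem_graded ha hb) X
      = act j b hb X ≫ act i a ha (X⟦j⟧) ≫ (shiftFunctorAdd' T j i (i + j) (by ring)).inv.app X
  act_natural : ∀ (i : ℤ) (a : R) (ha : a ∈ 𝒜 i) {X Y : T} (f : X ⟶ Y),
    f ≫ act i a ha Y = act i a ha X ≫ f⟦i⟧'
  act_shift : ∀ (i : ℤ) (a : R) (ha : a ∈ 𝒜 i) (X : T) (n : ℤ),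
    act i a ha (X⟦n⟧)
      = ((-1 : ℤ) ^ (i * n).natAbs) • ((act i a ha X)⟦n⟧' ≫ (shiftComm X i n).hom)

variable {𝒜 T}

/-- The action of a homogeneous element of `R` on the graded abelian group
`Hom*(X, Y) = ⊕ₙ Hom(X, Y⟦n⟧)`. -/
def CenterAction.hsmul (A : CenterAction 𝒜 T) {i : ℤ} {a : R} (ha : a ∈ 𝒜 i) {X Y : T} {n : ℤ}
    (f : X ⟶ Y⟦n⟧) : X ⟶ Y⟦n + i⟧ :=
  f ≫ A.act i a ha (Y⟦n⟧) ≫ (shiftFunctorAdd' T n i (n + i) rfl).inv.app Y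

/-- The homogeneous localization of the graded `R`-module `Hom*(X, Y)` at the homogeneous
prime `p` vanishes: every element is annihilated by some homogeneous `s ∉ p`. -/
def LocVanishes (A : CenterAction 𝒜 T) (p : SpecR 𝒜) (X Y : T) : Prop :=
  ∀ (n : ℤ) (f : X ⟶ Y⟦n⟧), ∃ (i : ℤ) (s : R) (hs : s ∈ 𝒜 i),
    s ∉ p.1.toIdeal ∧ A.hsmul hs f = 0

variable (T) in
/-- The subcategory `T_V` of `V`-torsion objects, for `V ⊆ Spec R` specialization closed. -/
def TVset (A : CenterAction 𝒜 T) (V : Set (SpecR 𝒜)) : Set T :=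
  {X | ∀ C : T, IsCompactObj T C → ∀ p : SpecR 𝒜, p ∉ V → LocVanishes A p C X}

/-- The local cohomology and localization functors `Γ_V`, `L_V` attached to the `R`-action on
`T`: for each specialization closed `V ⊆ Spec R`, `L_V` is the (essentially unique) localization
functor with `Ker L_V = T_V`, and `Γ_V` is defined by the exact localization triangle
`Γ_V X → X → L_V X → `. -/
structure BIKData (A : CenterAction 𝒜 T) where
  Γ : Set (SpecR 𝒜) → T ⥤ T
  Lf : Set (SpecR 𝒜) → T ⥤ T
  γ : ∀ V : Set (SpecR 𝒜), Γ V ⟶ 𝟭 T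
  η : ∀ V : Set (SpecR 𝒜), 𝟭 T ⟶ Lf V
  δ : ∀ (V : Set (SpecR 𝒜)) (X : T), (Lf V).obj X ⟶ ((Γ V).obj X)⟦(1 : ℤ)⟧
  tri : ∀ V : Set (SpecR 𝒜), SpecClosed V → ∀ X : T,
    Triangle.mk ((γ V).app X) ((η V).app X) (δ V X) ∈ distTriang T
  Lη_iso : ∀ V : Set (SpecR 𝒜), SpecClosed V → ∀ X : T,
    IsIso ((Lf V).map ((η V).app X))
  Lη_eq : ∀ V : Set (SpecR 𝒜), SpecClosed V → ∀ X : T,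
    (Lf V).map ((η V).app X) = (η V).app ((Lf V).obj X)
  kerL : ∀ V : Set (SpecR 𝒜), SpecClosed V → ∀ X : T,
    Limits.IsZero ((Lf V).obj X) ↔ X ∈ TVset T A V

namespace BIKData

variable {A : CenterAction 𝒜 T} (B : BIKData A)

/-- `X_p = L_{Z(p)} X`. -/
def locP (p : SpecR 𝒜) (X : T) : T := (B.Lf (Zset p)).obj X

/-- `Γ_p = Γ_{V(p)} ∘ L_{Z(p)}`. -/
def ΓP (p : SpecR 𝒜) : T ⥤ T := B.Lf (Zset p) ⋙ B.Γ (Vp p)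

/-- `supp_R X = { p ∈ Spec R | Γ_p X ≠ 0 }`. -/
def suppObj (X : T) : Set (SpecR 𝒜) := {p | ¬ Limits.IsZero ((B.ΓP p).obj X)}

/-- `supp_R T = ⋃_X supp_R X`. -/
def suppT : Set (SpecR 𝒜) := {p | ∃ X : T, p ∈ B.suppObj X}

/-- The support of a class of objects. -/
def suppSet (S : Set T) : Set (SpecR 𝒜) := ⋃ X ∈ S, B.suppObj X

/-- `supp_R⁻¹ U`, the class of objects supported in `U`. -/
def invSupp (U : Set (SpecR 𝒜)) : Set T := {X | B.suppObj X ⊆ U}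

/-- `Γ_p T`, the essential image of `Γ_p`. -/
def ΓPImage (p : SpecR 𝒜) : Set T := {X | ∃ Y : T, Nonempty (X ≅ (B.ΓP p).obj Y)}

/-- The local-global principle: each object is built from its local cohomology objects. -/
def LocalGlobal : Prop :=
  ∀ X : T, Loc T {X} = Loc T {Y | ∃ p : SpecR 𝒜, Y = (B.ΓP p).obj X}

end BIKData

/-- A localizing subcategory is minimal if it is nonzero and has no proper nonzero localizing
subcategories. -/
def IsMinimalLoc (S : Set T) : Prop :=
  IsLocalizing T S ∧ (∃ X ∈ S, ¬ Limits.IsZero X) ∧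
    ∀ S' : Set T, IsLocalizing T S' → S' ⊆ S →
      (∀ X ∈ S', Limits.IsZero X) ∨ S' = S

/-- `T` is stratified by the `R`-action: the local-global principle holds and each `Γ_p T`
is either zero or a minimal localizing subcategory. -/
def Stratified {A : CenterAction 𝒜 T} (B : BIKData A) : Prop :=
  B.LocalGlobal ∧
    ∀ p : SpecR 𝒜, (∀ X ∈ B.ΓPImage p, Limits.IsZero X) ∨ IsMinimalLoc (B.ΓPImage p)

/-- A graded `R`-submodule of `Hom*(X,Y)`. -/
structure HomSub (A : CenterAction 𝒜 T) (X Y : T) where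
  car : ∀ n : ℤ, AddSubgroup (X ⟶ Y⟦n⟧)
  hsmul_mem : ∀ (i : ℤ) (a : R) (ha : a ∈ 𝒜 i) (n : ℤ) (f : X ⟶ Y⟦n⟧),
    f ∈ car n → A.hsmul ha f ∈ car (n + i)

/-- The graded `R`-module `Hom*(X,Y)` is finitely generated. -/
def FGHom (A : CenterAction 𝒜 T) (X Y : T) : Prop :=
  ∃ F : Finset ((n : ℤ) × (X ⟶ Y⟦n⟧)),
    ∀ S : HomSub A X Y, (∀ g ∈ F, g.2 ∈ S.car g.1) → ∀ (n : ℤ) (f : X ⟶ Y⟦n⟧), f ∈ S.car n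

/-- The `R`-linear category `T` is noetherian: `End*(C)` is a finitely generated `R`-module
for each compact object `C`. -/
def NoetherianT (A : CenterAction 𝒜 T) : Prop :=
  ∀ C : T, IsCompactObj T C → FGHom A C C

end Action

section Extra

variable {R : Type u} [Ring R] {𝒜 : ℤ → AddSubgroup R} [GradedRing 𝒜]
variable {T : Type u'} [Category.{v} T] [HasZeroObject T] [Preadditive T] [HasShift T ℤ]
  [∀ n : ℤ, (CategoryTheory.shiftFunctor T n).Additive] [Pretriangulated T]
  [HasCoproducts.{v} T]

/-- A subset of `Spec R` closed under generalization. -/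
def GenClosed (U : Set (SpecR 𝒜)) : Prop :=
  ∀ p q : SpecR 𝒜, q ∈ U → p.1.toIdeal ≤ q.1.toIdeal → p ∈ U

/-- `Supp_R Hom*(X,Y) = { p | Hom*(X,Y)_p ≠ 0 }`, the big support of the graded `R`-module
`Hom*(X,Y)`. -/
def bigSuppHom (A : CenterAction 𝒜 T) (X Y : T) : Set (SpecR 𝒜) :=
  {p | ¬ LocVanishes A p X Y}

/-- `Supp_R X = ⋃_{C compact} Supp_R Hom*(C,X)`, the big support of an object. -/
def bigSuppObj (A : CenterAction 𝒜 T) (X : T) : Set (SpecR 𝒜) :=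
  {p | ∃ C : T, IsCompactObj T C ∧ ¬ LocVanishes A p C X}

/-- The graded `R`-module `Hom*(X,Y)` is `p`-local: every homogeneous element outside of `p`
acts invertibly on it. -/
def PLocalHom (A : CenterAction 𝒜 T) (p : SpecR 𝒜) (X Y : T) : Prop :=
  ∀ (i : ℤ) (s : R) (hs : s ∈ 𝒜 i), s ∉ p.1.toIdeal →
    ∀ n : ℤ, Function.Bijective fun f : X ⟶ Y⟦n⟧ => A.hsmul hs f

/-- `K` is a Koszul object `X ⫽ a` of the homogeneous element `a` of degree `i` on `X`,
i.e. there is an exact triangle `X → Σ^i X → K → `, the first map being given by the action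
of `a`. -/
def IsKoszul (A : CenterAction 𝒜 T) {i : ℤ} (a : R) (ha : a ∈ 𝒜 i) (X K : T) : Prop :=
  ∃ (w : X⟦i⟧ ⟶ K) (d : K ⟶ X⟦(1 : ℤ)⟧),
    Triangle.mk (A.act i a ha X) w d ∈ distTriang T

/-- Iterated Koszul object on a finite sequence of homogeneous elements. -/
inductive IsKoszulSeq (A : CenterAction 𝒜 T) :
    T → List ((i : ℤ) × {a : R // a ∈ 𝒜 i}) → T → Prop
  | nil (X : T) : IsKoszulSeq A X [] X
  | cons (X Y K : T) (i : ℤ) (a : {a : R // a ∈ 𝒜 i})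
      (l : List ((i : ℤ) × {a : R // a ∈ 𝒜 i})) :
      IsKoszulSeq A X l Y → IsKoszul A a.1 a.2 Y K → IsKoszulSeq A X (⟨i, a⟩ :: l) K

/-- `K` is a Koszul object `X ⫽ 𝔞` of the homogeneous ideal `𝔞` on `X`, obtained by iterating
the Koszul construction on some finite sequence of homogeneous generators of `𝔞`. -/
def IsKoszulIdeal (A : CenterAction 𝒜 T) (𝔞 : HomogeneousIdeal 𝒜) (X K : T) : Prop :=
  ∃ l : List ((i : ℤ) × {a : R // a ∈ 𝒜 i}),
    Ideal.span {x : R | ∃ s ∈ l, (s.2 : R) = x} = 𝔞.toIdeal ∧ IsKoszulSeq A X l K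

end Extra

section Hocolim

variable {T : Type u'} [Category.{v} T] [Preadditive T] [HasCoproductsOfShape ℕ T]

/-- The map `⊕ₙ Xₙ → ⊕ₙ Xₙ` given by `id - fₙ`, whose cone is the homotopy colimit. -/
noncomputable def hoColimMap {Xs : ℕ → T} (fs : ∀ n, Xs n ⟶ Xs (n + 1)) : (∐ Xs) ⟶ (∐ Xs) :=
  Sigma.desc fun n => Sigma.ι Xs n - fs n ≫ Sigma.ι Xs (n + 1)

variable [HasZeroObject T] [HasShift T ℤ]
  [∀ n : ℤ, (CategoryTheory.shiftFunctor T n).Additive] [Pretriangulated T]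

/-- A homotopy colimit of the sequence `X₀ → X₁ → X₂ → ⋯`, defined by an exact triangle
`⊕ Xₙ → ⊕ Xₙ → hocolim Xₙ → `. -/
structure HocolimData (Xs : ℕ → T) (fs : ∀ n, Xs n ⟶ Xs (n + 1)) where
  pt : T
  ι : (∐ Xs) ⟶ pt
  d : pt ⟶ (∐ Xs)⟦(1 : ℤ)⟧
  tri : Triangle.mk (hoColimMap fs) ι d ∈ distTriang T

end Hocolim

end BIK

set_option linter.unusedSectionVars false

namespace BIK

section KillSection

variable {R : Type u} [Ring R] {𝒜 : ℤ → AddSubgroup R} [GradedRing 𝒜]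
variable {T : Type u'} [Category.{v} T] [HasZeroObject T] [Preadditive T] [HasShift T ℤ]
  [∀ n : ℤ, (CategoryTheory.shiftFunctor T n).Additive] [Pretriangulated T]
  [HasCoproducts.{v} T]

theorem one_notMem (p : SpecR 𝒜) : (1 : R) ∉ p.1.toIdeal := fun h =>
  p.2.ne_top ((Ideal.eq_top_iff_one _).2 h)

theorem mul_notMem (p : SpecR 𝒜) {i j : ℤ} {a b : R} (ha : a ∈ 𝒜 i) (hb : b ∈ 𝒜 j)
    (h1 : a ∉ p.1.toIdeal) (h2 : b ∉ p.1.toIdeal) : a * b ∉ p.1.toIdeal := fun h =>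
  (p.2.mem_or_mem ha hb h).elim h1 h2

theorem mul_mem_right_hom (hcomm : IsGradedComm 𝒜) (I : Ideal R) {i j : ℤ} {a b : R}
    (ha : a ∈ 𝒜 i) (hb : b ∈ 𝒜 j) (h : a ∈ I) : a * b ∈ I := by
  rw [hcomm i j a b ha hb]
  exact zsmul_mem (I.mul_mem_left _ h) _

theorem act_congr (A : CenterAction 𝒜 T) {i i' : ℤ} (h : i = i') {a a' : R} (h' : a = a')
    (ha : a ∈ 𝒜 i) (ha' : a' ∈ 𝒜 i') (X : T) :
    A.act i a ha X = A.act i' a' ha' X ≫ eqToHom (by rw [h]) := by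
  subst h; subst h'; simp

theorem act_zero (A : CenterAction 𝒜 T) (i : ℤ) (X : T) (h : (0 : R) ∈ 𝒜 i) :
    A.act i 0 h X = 0 := by
  have := A.act_add i 0 0 h h X
  have h2 : A.act i (0 + 0) (add_mem h h) X = A.act i 0 h X := by
    rw [act_congr A rfl (add_zero 0) (add_mem h h) h]; simp
  rw [h2] at this
  simpa using this

theorem act_neg (A : CenterAction 𝒜 T) (i : ℤ) (a : R) (ha : a ∈ 𝒜 i) (X : T) :
    A.act i (-a) (neg_mem ha) X = - A.act i a ha X := by
  have := A.act_add i (-a) a (neg_mem ha) ha X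
  have h2 : A.act i (-a + a) (add_mem (neg_mem ha) ha) X = 0 := by
    rw [act_congr A rfl (neg_add_cancel a) _ (zero_mem _), act_zero]; simp
  rw [h2] at this
  exact eq_neg_of_add_eq_zero_left this.symm

/-- Multiplication by a homogeneous element outside `p` kills the morphism `f`. -/
def Kill (A : CenterAction 𝒜 T) (p : SpecR 𝒜) {X Y : T} (f : X ⟶ Y) : Prop :=
  ∃ (i : ℤ) (s : R) (hs : s ∈ 𝒜 i), s ∉ p.1.toIdeal ∧ f ≫ A.act i s hs Y = 0

variable {A : CenterAction 𝒜 T} {p : SpecR 𝒜}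

theorem Kill.comp_left {X Y Z : T} {f : X ⟶ Y} (h : Kill A p f) (g : Z ⟶ X) :
    Kill A p (g ≫ f) := by
  obtain ⟨i, s, hs, hp, e⟩ := h
  exact ⟨i, s, hs, hp, by rw [Category.assoc, e, comp_zero]⟩

theorem Kill.comp_right {X Y Z : T} {f : X ⟶ Y} (h : Kill A p f) (g : Y ⟶ Z) :
    Kill A p (f ≫ g) := by
  obtain ⟨i, s, hs, hp, e⟩ := h
  exact ⟨i, s, hs, hp, by rw [Category.assoc, A.act_natural, reassoc_of% e, zero_comp]⟩

theorem Kill.zero {X Y : T} : Kill A p (0 : X ⟶ Y) :=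
  ⟨0, 1, SetLike.one_mem_graded 𝒜, one_notMem p, zero_comp⟩

theorem act_mul_eq_zero {X Y : T} {f : X ⟶ Y} {i j : ℤ} {a b : R} (ha : a ∈ 𝒜 i) (hb : b ∈ 𝒜 j)
    (h : f ≫ A.act j b hb Y = 0) :
    f ≫ A.act (i + j) (a * b) (SetLike.mul_mem_graded ha hb) Y = 0 := by
  rw [A.act_mul i j a b ha hb, reassoc_of% h, zero_comp]

theorem act_mul_eq_zero' (hcomm : IsGradedComm 𝒜) {X Y : T} {f : X ⟶ Y} {i j : ℤ} {a b : R}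
    (ha : a ∈ 𝒜 i) (hb : b ∈ 𝒜 j) (h : f ≫ A.act i a ha Y = 0) :
    f ≫ A.act (i + j) (a * b) (SetLike.mul_mem_graded ha hb) Y = 0 := by
  have h1 := act_mul_eq_zero (A := A) hb ha h
  have h2 := hcomm i j a b ha hb
  rcases neg_one_pow_eq_or ℤ (i * j).natAbs with h3 | h3
  · rw [h3, one_smul] at h2
    rw [act_congr A (add_comm i j) h2 _ (SetLike.mul_mem_graded hb ha), reassoc_of% h1, zero_comp]
  · rw [h3, neg_smul, one_smul] at h2
    rw [act_congr A (add_comm i j) h2 _ (neg_mem (SetLike.mul_mem_graded hb ha)),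
      act_neg A (j + i) (b * a) (SetLike.mul_mem_graded hb ha),
      Preadditive.neg_comp, Preadditive.comp_neg, reassoc_of% h1, zero_comp, neg_zero]

theorem Kill.add (hcomm : IsGradedComm 𝒜) {X Y : T} {f g : X ⟶ Y} (hf : Kill A p f)
    (hg : Kill A p g) : Kill A p (f + g) := by
  obtain ⟨i, s, hs, hp, e⟩ := hf
  obtain ⟨j, t, ht, hq, e'⟩ := hg
  refine ⟨i + j, s * t, SetLike.mul_mem_graded hs ht, mul_notMem p hs ht hp hq, ?_⟩
  rw [Preadditive.add_comp, act_mul_eq_zero' hcomm hs ht e, act_mul_eq_zero hs ht e', add_zero]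

theorem Kill.sum (hcomm : IsGradedComm 𝒜) {X Y : T} {J : Type*} (s : Finset J) (f : J → (X ⟶ Y))
    (h : ∀ j ∈ s, Kill A p (f j)) : Kill A p (∑ j ∈ s, f j) := by
  classical
  induction s using Finset.induction_on with
  | empty => simpa using Kill.zero
  | insert a s ha ih =>
    rw [Finset.sum_insert ha]
    exact (h a (by simp)).add hcomm (ih fun j hj => h j (by simp [hj]))

theorem Kill.of_act {X Y : T} {f : X ⟶ Y} {j : ℤ} {t : R} (ht : t ∈ 𝒜 j) (hp : t ∉ p.1.toIdeal)
    (h : Kill A p (f ≫ A.act j t ht Y)) : Kill A p f := by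
  obtain ⟨i, s, hs, hs', e⟩ := h
  refine ⟨i + j, s * t, SetLike.mul_mem_graded hs ht, mul_notMem p hs ht hs' hp, ?_⟩
  rw [A.act_mul i j s t hs ht]
  simp only [Category.assoc] at e
  rw [reassoc_of% e, zero_comp]

theorem Kill.of_comp_mono {X Y Z : T} {f : X ⟶ Y} (g : Y ⟶ Z) [IsIso g]
    (h : Kill A p (f ≫ g)) : Kill A p f := by
  simpa using h.comp_right (inv g)

theorem Kill.of_comp_epi {X Y Z : T} {f : X ⟶ Y} (g : Z ⟶ X) [IsIso g]
    (h : Kill A p (g ≫ f)) : Kill A p f := by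
  simpa using h.comp_left (inv g)

theorem comp_act_shift_eq_zero {X Y : T} {f : X ⟶ Y} {i : ℤ} {s : R} (hs : s ∈ 𝒜 i) (n : ℤ)
    (h : f ≫ A.act i s hs Y = 0) : f⟦n⟧' ≫ A.act i s hs (Y⟦n⟧) = 0 := by
  rw [A.act_shift, Preadditive.comp_zsmul, ← Functor.map_comp_assoc, h]
  simp

theorem Kill.shift {X Y : T} {f : X ⟶ Y} (h : Kill A p f) (n : ℤ) : Kill A p (f⟦n⟧') := by
  obtain ⟨i, s, hs, hp, e⟩ := h
  exact ⟨i, s, hs, hp, comp_act_shift_eq_zero hs n e⟩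

theorem Kill.of_shift {X Y : T} {f : X ⟶ Y} (n : ℤ) (h : Kill A p (f⟦n⟧')) : Kill A p f := by
  have := h.shift (-n)
  rw [shift_shift_neg'] at this
  exact (this.of_comp_epi _).of_comp_mono _

theorem Kill.of_id_left {X Y : T} (h : Kill A p (𝟙 X)) (f : X ⟶ Y) : Kill A p f := by
  simpa using h.comp_right f

theorem Kill.of_id_right {X Y : T} (h : Kill A p (𝟙 Y)) (f : X ⟶ Y) : Kill A p f := by
  simpa using h.comp_left f

/-- exactness at `Y⟦n⟧` -/
theorem exists_lift_shift {Tr : Triangle T} (hTr : Tr ∈ distTriang T) (n : ℤ) {C : T}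
    (e : C ⟶ Tr.obj₂⟦n⟧) (h : e ≫ Tr.mor₂⟦n⟧' = 0) : ∃ g : C ⟶ Tr.obj₁⟦n⟧, e = g ≫ Tr.mor₁⟦n⟧' := by
  have h1 := Triangle.shift_distinguished Tr hTr n
  have key : ∃ g : C ⟶ Tr.obj₁⟦n⟧, e = g ≫ (n.negOnePow • Tr.mor₁⟦n⟧') :=
    Triangle.coyoneda_exact₂ _ h1 e (by
    change e ≫ (n.negOnePow • Tr.mor₂⟦n⟧') = 0
    rw [Linear.comp_units_smul, h, smul_zero])
  obtain ⟨g, hg⟩ := key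
  refine ⟨n.negOnePow • g, ?_⟩
  rw [hg]
  rw [Linear.comp_units_smul, Linear.units_smul_comp]

theorem Kill.of_triangle {Tr : Triangle T} (hTr : Tr ∈ distTriang T) {C : T}
    (e : C ⟶ Tr.obj₂) (h : Kill A p (e ≫ Tr.mor₂))
    (h' : ∀ (n : ℤ) (g : C ⟶ Tr.obj₁⟦n⟧), Kill A p (g ≫ Tr.mor₁⟦n⟧')) : Kill A p e := by
  obtain ⟨i, s, hs, hp, e0⟩ := h
  rw [Category.assoc, A.act_natural, ← Category.assoc] at e0
  obtain ⟨g, hg⟩ := exists_lift_shift hTr i _ e0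
  apply Kill.of_act hs hp
  rw [hg]
  exact h' _ _

/-- All morphisms `X → Y⟦n⟧` are killed. -/
def LV (A : CenterAction 𝒜 T) (p : SpecR 𝒜) (X Y : T) : Prop :=
  ∀ (n : ℤ) (f : X ⟶ Y⟦n⟧), Kill A p f

theorem locVanishes_iff (X Y : T) : LocVanishes A p X Y ↔ LV A p X Y := by
  unfold LocVanishes LV Kill CenterAction.hsmul
  refine forall_congr' fun n => forall_congr' fun f => ?_
  refine exists_congr fun i => exists_congr fun s => exists_congr fun hs => and_congr_right fun _ => ?_
  rw [← Category.assoc]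
  constructor
  · intro h
    exact (cancel_mono ((shiftFunctorAdd' T n i (n + i) rfl).inv.app Y)).1 (by rw [h, zero_comp])
  · intro h
    rw [h, zero_comp]

theorem LV.of_iso_right {X Y Y' : T} (e : Y ≅ Y') (h : LV A p X Y) : LV A p X Y' := fun n f =>
  (h n (f ≫ e.inv⟦n⟧')).of_comp_mono _

theorem LV.of_iso_left {X X' Y : T} (e : X ≅ X') (h : LV A p X Y) : LV A p X' Y := fun n f =>
  (h n (e.hom ≫ f)).of_comp_epi _

theorem LV.shift_right {X Y : T} (h : LV A p X Y) (m : ℤ) : LV A p X (Y⟦m⟧) := fun n f =>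
  (h (m + n) (f ≫ (shiftFunctorAdd' T m n (m + n) rfl).inv.app Y)).of_comp_mono _

theorem LV.shift_left {X Y : T} (h : LV A p X Y) (m : ℤ) : LV A p (X⟦m⟧) Y := fun n f => by
  apply Kill.of_shift (-m)
  exact ((h.shift_right n) (-m) ((shiftShiftNeg X m).inv ≫ f⟦-m⟧')).of_comp_epi _

theorem LV.kill {X Y : T} (h : LV A p X Y) (f : X ⟶ Y) : Kill A p f :=
  (h 0 (f ≫ (shiftFunctorZero T ℤ).inv.app Y)).of_comp_mono _

theorem LV.of_kill_left {X Y : T} (h : Kill A p (𝟙 X)) : LV A p X Y := fun _ f => h.of_id_left f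

theorem LV.of_kill_right {X Y : T} (h : Kill A p (𝟙 Y)) : LV A p X Y := fun n f =>
  Kill.of_id_right (by simpa using h.shift n) f

theorem LV.of_isZero_right {X Y : T} (h : IsZero Y) : LV A p X Y :=
  LV.of_kill_right (by rw [h.eq_zero_of_src (𝟙 Y)]; exact Kill.zero)

theorem LV.ext_right {X : T} {Tr : Triangle T} (hTr : Tr ∈ distTriang T) (h1 : LV A p X Tr.obj₁)
    (h2 : LV A p X Tr.obj₂) : LV A p X Tr.obj₃ := fun n f => by
  have h := rot_of_distTriang _ (Triangle.shift_distinguished Tr hTr n)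
  refine Kill.of_triangle h f ?_ ?_
  · exact ((h1.shift_right n).shift_right 1).kill _
  · intro m g
    exact Kill.comp_right ((h2.shift_right n) m g) _

theorem LV.ext_left {Y : T} {Tr : Triangle T} (hTr : Tr ∈ distTriang T) (h1 : LV A p Tr.obj₁ Y)
    (h2 : LV A p Tr.obj₂ Y) : LV A p Tr.obj₃ Y := fun n f => by
  obtain ⟨i, s, hs, hp, e0⟩ := h2 n (Tr.mor₂ ≫ f)
  rw [Category.assoc] at e0
  obtain ⟨g, hg⟩ := Triangle.yoneda_exact₃ _ hTr _ e0
  apply Kill.of_act hs hp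
  rw [hg]
  exact (((h1.shift_left 1).shift_right n) _ g).comp_left _

end KillSection

end BIK

namespace BIK

section CompactSection

open scoped Classical

variable {T : Type u'} [Category.{v} T] [HasZeroObject T] [Preadditive T] [HasShift T ℤ]
  [∀ n : ℤ, (CategoryTheory.shiftFunctor T n).Additive] [Pretriangulated T]
  [HasCoproducts.{v} T]

theorem sigma_ι_π_sum {J : Type v} (f : J → T) (s : Finset J) (j : J) :
    Sigma.ι f j ≫ (∑ k ∈ s, Sigma.π f k ≫ Sigma.ι f k) = if j ∈ s then Sigma.ι f j else 0 := by
  rw [Preadditive.comp_sum]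
  split_ifs with h
  · rw [Finset.sum_eq_single_of_mem j h]
    · rw [← Category.assoc, Sigma.ι_π_eq_id, Category.id_comp]
    · intro k _ hk
      rw [← Category.assoc, Sigma.ι_π_of_ne _ hk.symm, zero_comp]
  · apply Finset.sum_eq_zero
    intro k hk
    rw [← Category.assoc, Sigma.ι_π_of_ne _ (by rintro rfl; exact h hk), zero_comp]


theorem sigmaHom_of (C : T) {J : Type v} (f : J → T) (i : J) (x : C ⟶ f i) :
    sigmaHom T C f (DirectSum.of (fun j => (C ⟶ f j)) i x) = x ≫ Sigma.ι f i := by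
  have : (fun a b : J => Classical.propDecidable (a = b)) = Classical.decEq J :=
    Subsingleton.elim _ _
  rw [this]
  unfold sigmaHom
  exact DirectSum.toAddMonoid_of (β := fun j => (C ⟶ f j)) _ i x

/-- finite-support criterion for compactness -/
theorem isCompactObj_iff (C : T) : IsCompactObj T C ↔
    ∀ (J : Type v) (f : J → T) (h : C ⟶ ∐ f), ∃ s : Finset J,
      h = ∑ k ∈ s, h ≫ Sigma.π f k ≫ Sigma.ι f k := by
  constructor
  · intro hC J f h
    obtain ⟨x, rfl⟩ := (hC J f).2 h
    induction x using DirectSum.induction_on with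
    | zero => exact ⟨∅, by simp⟩
    | of i x =>
      refine ⟨{i}, ?_⟩
      rw [sigmaHom_of, Finset.sum_singleton]
      simp
    | add x y hx hy =>
      obtain ⟨s, hs⟩ := hx
      obtain ⟨t, ht⟩ := hy
      refine ⟨s ∪ t, ?_⟩
      rw [map_add]
      generalize sigmaHom T C f x = X at *
      generalize sigmaHom T C f y = Y at *
      have aux : ∀ (u u' : Finset J) (Z : C ⟶ ∐ f), u ⊆ u' →
          Z = ∑ k ∈ u, Z ≫ Sigma.π f k ≫ Sigma.ι f k →
          Z = ∑ k ∈ u', Z ≫ Sigma.π f k ≫ Sigma.ι f k := by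
        intro u u' Z hu hZ
        have e1 : Z = Z ≫ ∑ k ∈ u, Sigma.π f k ≫ Sigma.ι f k := by
          rw [Preadditive.comp_sum]; exact hZ
        rw [← Preadditive.comp_sum]
        rw [e1, Category.assoc]
        congr 1
        simp only [Preadditive.sum_comp, Category.assoc, sigma_ι_π_sum]
        refine Finset.sum_congr rfl fun k hk => ?_
        rw [if_pos (hu hk)]
      simp only [Preadditive.add_comp, Finset.sum_add_distrib]
      rw [← aux s _ X Finset.subset_union_left hs, ← aux t _ Y Finset.subset_union_right ht]
  · intro H J f
    have hof : ∀ (i : J) (x : C ⟶ f i),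
        sigmaHom T C f (DirectSum.of (fun j => (C ⟶ f j)) i x) = x ≫ Sigma.ι f i := by
      exact sigmaHom_of C f
    have hπ : ∀ (x : DirectSum J fun j => (C ⟶ f j)) (k : J),
        sigmaHom T C f x ≫ Sigma.π f k = x k := by
      intro x k
      induction x using DirectSum.induction_on with
      | zero => simp
      | of i x =>
        rw [hof, Category.assoc]
        by_cases hik : i = k
        · subst hik; simp
        · rw [Sigma.ι_π_of_ne _ hik, comp_zero, DirectSum.of_eq_of_ne _ _ _ (Ne.symm hik)]
      | add x y hx hy => rw [map_add, Preadditive.add_comp, hx, hy]; rfl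
    constructor
    · intro x y hxy
      refine DFinsupp.ext fun k => ?_
      change x k = y k
      rw [← hπ, ← hπ, hxy]
    · intro h
      obtain ⟨s, hs⟩ := H J f h
      refine ⟨∑ k ∈ s, DirectSum.of (fun j => (C ⟶ f j)) k (h ≫ Sigma.π f k), ?_⟩
      rw [map_sum]
      conv_rhs => rw [hs]
      exact Finset.sum_congr rfl fun k _ => by rw [hof, Category.assoc]

/-- the compactness criterion in terms of idempotents -/
theorem isCompactObj_iff' (C : T) : IsCompactObj T C ↔
    ∀ (J : Type v) (f : J → T) (h : C ⟶ ∐ f), ∃ s : Finset J,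
      h ≫ (𝟙 _ - ∑ k ∈ s, Sigma.π f k ≫ Sigma.ι f k) = 0 := by
  rw [isCompactObj_iff]
  refine forall_congr' fun J => forall_congr' fun f => forall_congr' fun h =>
    exists_congr fun s => ?_
  rw [Preadditive.comp_sub, Category.comp_id, sub_eq_zero, Preadditive.comp_sum]

theorem sigma_compl_mul {J : Type v} (f : J → T) (s t : Finset J) :
    (𝟙 (∐ f) - ∑ k ∈ s, Sigma.π f k ≫ Sigma.ι f k) ≫
      (𝟙 (∐ f) - ∑ k ∈ t, Sigma.π f k ≫ Sigma.ι f k) =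
      𝟙 _ - ∑ k ∈ s ∪ t, Sigma.π f k ≫ Sigma.ι f k := by
  refine Sigma.hom_ext _ _ fun j => ?_
  by_cases h1 : j ∈ s <;> by_cases h2 : j ∈ t <;>
  simp [← Category.assoc, Preadditive.comp_sub, Preadditive.sub_comp, sigma_ι_π_sum, h1, h2]

theorem IsCompactObj.of_iso {C C' : T} (e : C ≅ C') (h : IsCompactObj T C) :
    IsCompactObj T C' := by
  rw [isCompactObj_iff'] at *
  intro J f g
  obtain ⟨s, hs⟩ := h J f (e.hom ≫ g)
  refine ⟨s, ?_⟩
  rwa [Category.assoc, Preadditive.IsIso.comp_left_eq_zero] at hs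

theorem IsCompactObj.shift {C : T} (hC : IsCompactObj T C) (n : ℤ) : IsCompactObj T (C⟦n⟧) := by
  rw [isCompactObj_iff'] at *
  intro J f g
  let F := shiftFunctor T (-n)
  let φ : (∐ fun j => (f j)⟦-n⟧) ⟶ (∐ f)⟦-n⟧ := Sigma.desc fun j => (Sigma.ι f j)⟦-n⟧'
  have hφ : IsIso φ := by
    have : φ = sigmaComparison F f := rfl
    rw [this]
    infer_instance
  let g' : C ⟶ ∐ fun j => (f j)⟦-n⟧ := (shiftShiftNeg C n).inv ≫ g⟦-n⟧' ≫ inv φ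
  obtain ⟨s, hs⟩ := hC J _ g'
  refine ⟨s, ?_⟩
  have comm : (𝟙 _ - ∑ k ∈ s, Sigma.π (fun j => (f j)⟦-n⟧) k ≫ Sigma.ι (fun j => (f j)⟦-n⟧) k) ≫ φ
      = φ ≫ (𝟙 _ - ∑ k ∈ s, Sigma.π f k ≫ Sigma.ι f k)⟦-n⟧' := by
    refine Sigma.hom_ext _ _ fun j => ?_
    have h1 : Sigma.ι (fun j => (f j)⟦-n⟧) j ≫ φ = (Sigma.ι f j)⟦-n⟧' := by simp [φ]
    rw [← Category.assoc, ← Category.assoc, h1, ← Functor.map_comp, Preadditive.comp_sub,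
      Preadditive.comp_sub, sigma_ι_π_sum, sigma_ι_π_sum]
    split_ifs <;> simp [h1]
  have h2 : g⟦-n⟧' = (shiftShiftNeg C n).hom ≫ g' ≫ φ := by
    simp only [g', Category.assoc, IsIso.inv_hom_id, Category.comp_id, Iso.hom_inv_id_assoc]
  apply (shiftFunctor T (-n)).map_injective
  rw [Functor.map_comp, h2, Category.assoc, Category.assoc, ← comm, reassoc_of% hs,
    zero_comp, comp_zero, Functor.map_zero]

theorem IsCompactObj.cone {Tr : Triangle T} (hTr : Tr ∈ distTriang T)
    (h1 : IsCompactObj T Tr.obj₁) (h2 : IsCompactObj T Tr.obj₂) : IsCompactObj T Tr.obj₃ := by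
  have h1' := h1.shift 1
  rw [isCompactObj_iff'] at *
  intro J f g
  obtain ⟨s, hs⟩ := h2 J f (Tr.mor₂ ≫ g)
  rw [Category.assoc] at hs
  obtain ⟨k, hk⟩ := Triangle.yoneda_exact₃ _ hTr _ hs
  obtain ⟨t, ht⟩ := h1' J f k
  refine ⟨s ∪ t, ?_⟩
  rw [← sigma_compl_mul, ← Category.assoc, hk, Category.assoc, ht, comp_zero]

end CompactSection

end BIK

namespace BIK

section KoszulSection

variable {R : Type u} [Ring R] {𝒜 : ℤ → AddSubgroup R} [GradedRing 𝒜]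
variable {T : Type u'} [Category.{v} T] [HasZeroObject T] [Preadditive T] [HasShift T ℤ]
  [∀ n : ℤ, (CategoryTheory.shiftFunctor T n).Additive] [Pretriangulated T]
  [HasCoproducts.{v} T]
variable {A : CenterAction 𝒜 T} {p : SpecR 𝒜}

theorem LV.coprod (hcomm : IsGradedComm 𝒜) {C : T} (hC : IsCompactObj T C) {J : Type v}
    (f : J → T) (h : ∀ j, LV A p C (f j)) : LV A p C (∐ f) := by
  classical
  intro n g
  apply Kill.of_shift (-n)
  apply Kill.of_comp_mono (shiftShiftNeg (∐ f) n).hom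
  obtain ⟨s, hs⟩ := (isCompactObj_iff _).1 (hC.shift (-n)) J f (g⟦-n⟧' ≫ (shiftShiftNeg (∐ f) n).hom)
  rw [hs]
  refine Kill.sum hcomm s _ fun j _ => ?_
  rw [← Category.assoc]
  exact Kill.comp_right (((h j).shift_left (-n)).kill _) _

theorem isLocalizing_LV (hcomm : IsGradedComm 𝒜) {C : T} (hC : IsCompactObj T C) :
    IsLocalizing T {X : T | LV A p C X} where
  zero_mem := fun _ h => LV.of_isZero_right h
  iso_mem := fun e h => LV.of_iso_right e h
  shift_mem := fun _ h n => LV.shift_right h n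
  ext_mem := fun _ hTr h1 h2 => LV.ext_right hTr h1 h2
  coprod_mem := fun _ f h => LV.coprod hcomm hC f h

theorem IsLocalizing.inter {S S' : Set T} (h : IsLocalizing T S) (h' : IsLocalizing T S') :
    IsLocalizing T (S ∩ S') where
  zero_mem := fun X hX => ⟨h.zero_mem X hX, h'.zero_mem X hX⟩
  iso_mem := fun e hX => ⟨h.iso_mem e hX.1, h'.iso_mem e hX.2⟩
  shift_mem := fun X hX n => ⟨h.shift_mem X hX.1 n, h'.shift_mem X hX.2 n⟩
  ext_mem := fun _ hTr h1 h2 => ⟨h.ext_mem _ hTr h1.1 h2.1, h'.ext_mem _ hTr h1.2 h2.2⟩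
  coprod_mem := fun J f hf => ⟨h.coprod_mem J f fun j => (hf j).1, h'.coprod_mem J f fun j => (hf j).2⟩

theorem isLocalizing_forall {ι : Sort*} {P : ι → Set T} (h : ∀ i, IsLocalizing T (P i)) :
    IsLocalizing T {X | ∀ i, X ∈ P i} where
  zero_mem := fun X hX i => (h i).zero_mem X hX
  iso_mem := fun e hX i => (h i).iso_mem e (hX i)
  shift_mem := fun X hX n i => (h i).shift_mem X (hX i) n
  ext_mem := fun _ hTr h1 h2 i => (h i).ext_mem _ hTr (h1 i) (h2 i)
  coprod_mem := fun J f hf i => (h i).coprod_mem J f fun j => hf j i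

theorem mem_TVset_iff {V : Set (SpecR 𝒜)} {X : T} : X ∈ TVset T A V ↔
    ∀ C : T, IsCompactObj T C → ∀ p : SpecR 𝒜, p ∉ V → LV A p C X := by
  simp only [← locVanishes_iff]
  rfl

theorem isLocalizing_TVset (hcomm : IsGradedComm 𝒜) (V : Set (SpecR 𝒜)) :
    IsLocalizing T (TVset T A V) := by
  have : TVset T A V = {X : T | ∀ x : {x : T × SpecR 𝒜 // IsCompactObj T x.1 ∧ x.2 ∉ V},
      X ∈ {X : T | LV A x.1.2 x.1.1 X}} := by
    ext X
    rw [mem_TVset_iff]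
    exact ⟨fun h x => h _ x.2.1 _ x.2.2, fun h C hC p hp => h ⟨⟨C, p⟩, hC, hp⟩⟩
  rw [this]
  exact isLocalizing_forall fun x => isLocalizing_LV hcomm x.2.1

theorem Loc_subset {S A' : Set T} (hS : IsLocalizing T S) (h : A' ⊆ S) : Loc T A' ⊆ S :=
  Set.sInter_subset_of_mem ⟨hS, h⟩

theorem subset_Loc (A' : Set T) : A' ⊆ Loc T A' := Set.subset_sInter fun _ h => h.2

theorem koszul_exists (A : CenterAction 𝒜 T) {i : ℤ} (a : R) (ha : a ∈ 𝒜 i) (X : T) :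
    ∃ K, IsKoszul A a ha X K := by
  obtain ⟨K, w, d, h⟩ := distinguished_cocone_triangle (A.act i a ha X)
  exact ⟨K, w, d, h⟩

theorem koszulSeq_exists (A : CenterAction 𝒜 T) (X : T)
    (l : List ((i : ℤ) × {a : R // a ∈ 𝒜 i})) : ∃ K, IsKoszulSeq A X l K := by
  induction l with
  | nil => exact ⟨X, .nil X⟩
  | cons a l ih =>
    obtain ⟨Y, hY⟩ := ih
    obtain ⟨K, hK⟩ := koszul_exists A a.2.1 a.2.2 Y
    exact ⟨K, .cons X Y K a.1 a.2 l hY hK⟩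

section single

variable {i : ℤ} {a : R} {ha : a ∈ 𝒜 i} {X K : T}

theorem IsKoszul.compact (h : IsKoszul A a ha X K) (hX : IsCompactObj T X) :
    IsCompactObj T K := by
  obtain ⟨w, d, h⟩ := h
  exact IsCompactObj.cone h hX (hX.shift i)

theorem IsKoszul.LV_left (h : IsKoszul A a ha X K) {Y : T} (hX : LV A p X Y) : LV A p K Y := by
  obtain ⟨w, d, h⟩ := h
  exact LV.ext_left h hX (hX.shift_left i)

theorem IsKoszul.mem_localizing (h : IsKoszul A a ha X K) {S : Set T} (hS : IsLocalizing T S)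
    (hX : X ∈ S) : K ∈ S := by
  obtain ⟨w, d, h⟩ := h
  exact hS.ext_mem _ h hX (hS.shift_mem X hX i)

theorem koszul_w {w : X⟦i⟧ ⟶ K} {d : K ⟶ X⟦(1 : ℤ)⟧}
    (h : Triangle.mk (A.act i a ha X) w d ∈ distTriang T) : w ≫ A.act i a ha K = 0 := by
  rw [A.act_natural, A.act_shift]
  have h1 : A.act i a ha X ≫ w = 0 := comp_distTriang_mor_zero₁₂ _ h
  have h2 : (shiftComm X i i).hom = 𝟙 _ := by
    simp [shiftComm, shiftFunctorComm_eq_refl]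
  rw [h2, Category.comp_id, Preadditive.zsmul_comp, ← Functor.map_comp, h1, Functor.map_zero,
    smul_zero]

theorem koszul_d {w : X⟦i⟧ ⟶ K} {d : K ⟶ X⟦(1 : ℤ)⟧}
    (h : Triangle.mk (A.act i a ha X) w d ∈ distTriang T) :
    d ≫ A.act i a ha (X⟦(1 : ℤ)⟧) = 0 := by
  have h1 : d ≫ (A.act i a ha X)⟦(1 : ℤ)⟧' = 0 := comp_distTriang_mor_zero₃₁ _ h
  rw [A.act_shift, Preadditive.comp_zsmul, reassoc_of% h1, zero_comp, smul_zero]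

theorem kill_id_of_kill {w : X⟦i⟧ ⟶ K} {d : K ⟶ X⟦(1 : ℤ)⟧}
    (h : Triangle.mk (A.act i a ha X) w d ∈ distTriang T) (hw : Kill A p w) (hd : Kill A p d) :
    Kill A p (𝟙 K) := by
  have h' := rot_of_distTriang _ h
  refine Kill.of_triangle h' (𝟙 K) (hd.comp_left _) fun n g => ?_
  exact (hw.shift n).comp_left _

theorem IsKoszul.kill_id (h : IsKoszul A a ha X K) (hp : a ∉ p.1.toIdeal) : Kill A p (𝟙 K) := by
  obtain ⟨w, d, h⟩ := h
  exact kill_id_of_kill h ⟨_, _, _, hp, koszul_w h⟩ ⟨_, _, _, hp, koszul_d h⟩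

theorem IsKoszul.kill_id' (h : IsKoszul A a ha X K) (hX : Kill A p (𝟙 X)) : Kill A p (𝟙 K) := by
  obtain ⟨w, d, h⟩ := h
  refine kill_id_of_kill h (Kill.of_id_left ?_ _) (Kill.of_id_right ?_ _)
  · simpa using hX.shift i
  · simpa using hX.shift 1

/-- no maps from `K` to any shift of `F` -/
def NoMap (K F : T) : Prop := ∀ (n : ℤ) (f : K ⟶ F⟦n⟧), f = 0

theorem act_shift_isIso {F : T} (hF : IsIso (A.act i a ha F)) (n : ℤ) :
    IsIso (A.act i a ha (F⟦n⟧)) := by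
  rw [A.act_shift]
  rcases neg_one_pow_eq_or ℤ (i * n).natAbs with h3 | h3
  · rw [h3, one_smul]; infer_instance
  · rw [h3, neg_smul, one_smul]
    exact ⟨⟨-inv ((A.act i a ha F)⟦n⟧' ≫ (shiftComm F i n).hom), by simp, by simp⟩⟩

theorem IsKoszul.noMap (h : IsKoszul A a ha X K) {F : T} (hF : IsIso (A.act i a ha F)) :
    NoMap K F := by
  obtain ⟨w, d, h⟩ := h
  intro n f
  have := act_shift_isIso hF n
  have h1 : w ≫ f = 0 := by
    rw [← cancel_mono (A.act i a ha (F⟦n⟧)), Category.assoc, A.act_natural, ← Category.assoc,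
      koszul_w h, zero_comp, zero_comp]
  have key : ∃ k : X⟦(1 : ℤ)⟧ ⟶ F⟦n⟧, f = d ≫ k := Triangle.yoneda_exact₃ _ h f h1
  obtain ⟨k, hk⟩ := key
  rw [hk, ← cancel_mono (A.act i a ha (F⟦n⟧)), Category.assoc, A.act_natural, ← Category.assoc,
    koszul_d h, zero_comp, zero_comp]

theorem NoMap.shift_left {K F : T} (h : NoMap K F) (m : ℤ) : NoMap (K⟦m⟧) F := fun n f => by
  apply (shiftFunctor T (-m)).map_injective
  have := h (n + -m) ((shiftShiftNeg K m).inv ≫ f⟦-m⟧' ≫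
    (shiftFunctorAdd' T n (-m) (n + -m) rfl).inv.app F)
  rw [← Category.assoc] at this
  rw [Functor.map_zero]
  have h2 := (cancel_mono ((shiftFunctorAdd' T n (-m) (n + -m) rfl).inv.app F)).1
    (this.trans zero_comp.symm)
  exact (cancel_epi (shiftShiftNeg K m).inv).1 (h2.trans comp_zero.symm)

theorem IsKoszul.noMap' (h : IsKoszul A a ha X K) {F : T} (hF : NoMap X F) : NoMap K F := by
  obtain ⟨w, d, h⟩ := h
  intro n f
  obtain ⟨k, hk⟩ := Triangle.yoneda_exact₃ _ h f ((hF.shift_left i) n _)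
  rw [hk, (hF.shift_left 1) n k]
  exact comp_zero

theorem IsKoszul.isIso_of_noMap (h : IsKoszul A a ha X K) (hF : NoMap K X) :
    IsIso (A.act i a ha X) := by
  obtain ⟨w, d, h⟩ := h
  have hd : d = 0 := hF 1 d
  obtain ⟨σ, hσ⟩ := Triangle.coyoneda_exact₃ _ h (𝟙 K) (by
    change 𝟙 K ≫ d = 0
    rw [hd, comp_zero])
  have hσ0 : σ = 0 := hF i σ
  have hz : IsZero K := by
    rw [IsZero.iff_id_eq_zero, hσ, hσ0]
    exact zero_comp
  exact (Triangle.isZero₃_iff_isIso₁ _ h).1 hz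

end single

theorem IsKoszulSeq.compact {X K : T} {l : List ((i : ℤ) × {a : R // a ∈ 𝒜 i})}
    (h : IsKoszulSeq A X l K) (hX : IsCompactObj T X) : IsCompactObj T K := by
  induction h with
  | nil => exact hX
  | cons Y K i a l h1 h2 ih => exact h2.compact ih

theorem IsKoszulSeq.LV_left {X K : T} {l : List ((i : ℤ) × {a : R // a ∈ 𝒜 i})}
    (h : IsKoszulSeq A X l K) {Y : T} (hX : LV A p X Y) : LV A p K Y := by
  induction h with
  | nil => exact hX
  | cons Y K i a l h1 h2 ih => exact h2.LV_left ih

theorem IsKoszulSeq.kill_id {X K : T} {l : List ((i : ℤ) × {a : R // a ∈ 𝒜 i})}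
    (h : IsKoszulSeq A X l K) {s : (i : ℤ) × {a : R // a ∈ 𝒜 i}} (hs : s ∈ l)
    (hp : s.2.1 ∉ p.1.toIdeal) : Kill A p (𝟙 K) := by
  induction h with
  | nil => simp at hs
  | cons Y K i a l h1 h2 ih =>
    rcases List.mem_cons.1 hs with rfl | hs
    · exact h2.kill_id hp
    · exact h2.kill_id' (ih hs)

theorem IsKoszulSeq.noMap {X K : T} {l : List ((i : ℤ) × {a : R // a ∈ 𝒜 i})}
    (h : IsKoszulSeq A X l K) {s : (i : ℤ) × {a : R // a ∈ 𝒜 i}} (hs : s ∈ l) {F : T}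
    (hF : IsIso (A.act s.1 s.2.1 s.2.2 F)) : NoMap K F := by
  induction h with
  | nil => simp at hs
  | cons Y K i a l h1 h2 ih =>
    rcases List.mem_cons.1 hs with rfl | hs
    · exact h2.noMap hF
    · exact h2.noMap' (ih hs)

end KoszulSection

end BIK

namespace BIK

section Nakayama

variable {R : Type u} [Ring R] {𝒜 : ℤ → AddSubgroup R} [GradedRing 𝒜]
variable {T : Type u'} [Category.{v} T] [HasZeroObject T] [Preadditive T] [HasShift T ℤ]
  [∀ n : ℤ, (CategoryTheory.shiftFunctor T n).Additive] [Pretriangulated T]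
  [HasCoproducts.{v} T]
variable {A : CenterAction 𝒜 T} {p : SpecR 𝒜}

/-- The action on `Hom*`, with a flexible target degree. -/
def hs (A : CenterAction 𝒜 T) {n i m : ℤ} (h : n + i = m) {a : R} (ha : a ∈ 𝒜 i) {X Y : T}
    (f : X ⟶ Y⟦n⟧) : X ⟶ Y⟦m⟧ :=
  f ≫ A.act i a ha (Y⟦n⟧) ≫ (shiftFunctorAdd' T n i m h).inv.app Y

variable {X Y : T}

theorem hs_eq_hsmul {n i : ℤ} {a : R} (ha : a ∈ 𝒜 i) (f : X ⟶ Y⟦n⟧) :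
    hs A rfl ha f = A.hsmul ha f := rfl

theorem hs_add {n i m : ℤ} (h : n + i = m) {a : R} (ha : a ∈ 𝒜 i) (f g : X ⟶ Y⟦n⟧) :
    hs A h ha (f + g) = hs A h ha f + hs A h ha g := by
  simp [hs]

theorem hs_neg {n i m : ℤ} (h : n + i = m) {a : R} (ha : a ∈ 𝒜 i) (f : X ⟶ Y⟦n⟧) :
    hs A h ha (-f) = - hs A h ha f := by
  simp [hs]

theorem hs_zero {n i m : ℤ} (h : n + i = m) {a : R} (ha : a ∈ 𝒜 i) :
    hs A h ha (0 : X ⟶ Y⟦n⟧) = 0 := by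
  simp [hs]

theorem hs_add_left {n i m : ℤ} (h : n + i = m) {a b : R} (ha : a ∈ 𝒜 i) (hb : b ∈ 𝒜 i)
    (f : X ⟶ Y⟦n⟧) : hs A h (add_mem ha hb) f = hs A h ha f + hs A h hb f := by
  simp [hs, A.act_add _ _ _ ha hb]

theorem hs_neg_left {n i m : ℤ} (h : n + i = m) {a : R} (ha : a ∈ 𝒜 i)
    (f : X ⟶ Y⟦n⟧) : hs A h (neg_mem ha) f = - hs A h ha f := by
  simp [hs, act_neg A _ _ ha]

theorem hs_zero_left {n i m : ℤ} (h : n + i = m) (h0 : (0 : R) ∈ 𝒜 i)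
    (f : X ⟶ Y⟦n⟧) : hs A h h0 f = 0 := by
  simp [hs, act_zero]

theorem hs_one {n m : ℤ} (h : n + 0 = m) (f : X ⟶ Y⟦n⟧) (f' : X ⟶ Y⟦m⟧)
    (e : f' = f ≫ eqToHom (by rw [← h, add_zero])) :
    hs A h (SetLike.one_mem_graded 𝒜) f = f' := by
  obtain rfl : n = m := by omega
  simp [hs, e, A.act_one, shiftFunctorAdd'_add_zero_inv_app]

theorem hs_one' {n : ℤ} (f : X ⟶ Y⟦n⟧) :
    hs A (add_zero n) (SetLike.one_mem_graded 𝒜) f = f := hs_one _ _ _ (by simp)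

theorem hs_congr {n i i' m : ℤ} (h : n + i = m) (h' : n + i' = m) {a a' : R} (ha : a ∈ 𝒜 i)
    (ha' : a' ∈ 𝒜 i') (e : a = a') (f : X ⟶ Y⟦n⟧) : hs A h ha f = hs A h' ha' f := by
  obtain rfl : i = i' := by omega
  subst e
  rfl

theorem hs_hs {n i m j k l : ℤ} (h : n + i = m) (h' : m + j = k) (hl : j + i = l)
    (h'' : n + l = k) {a b : R} (ha : a ∈ 𝒜 i)
    (hb : b ∈ 𝒜 j) (hab : b * a ∈ 𝒜 l) (f : X ⟶ Y⟦n⟧) :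
    hs A h' hb (hs A h ha f) = hs A h'' hab f := by
  subst hl
  have h1 := shiftFunctorAdd'_assoc_inv_app (C := T) n i j m (j + i) k h (by ring) (by omega) Y
  unfold hs
  rw [A.act_mul j i b a hb ha]
  simp only [Category.assoc]
  rw [← h1]
  rw [reassoc_of% (A.act_natural j b hb ((shiftFunctorAdd' T n i m h).inv.app Y))]

theorem hs_eq_zero_iff {n i m : ℤ} (h : n + i = m) {a : R} (ha : a ∈ 𝒜 i) (f : X ⟶ Y⟦n⟧) :
    hs A h ha f = 0 ↔ f ≫ A.act i a ha (Y⟦n⟧) = 0 := by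
  unfold hs
  rw [← Category.assoc]
  constructor
  · intro h1
    exact (cancel_mono ((shiftFunctorAdd' T n i m h).inv.app Y)).1 (h1.trans zero_comp.symm)
  · intro h1
    rw [h1, zero_comp]

theorem hs_comm (hcomm : IsGradedComm 𝒜) {n i m j k m' : ℤ} (h : n + i = m) (h' : m + j = k)
    (h1 : n + j = m') (h1' : m' + i = k) {a b : R} (ha : a ∈ 𝒜 i) (hb : b ∈ 𝒜 j)
    (f : X ⟶ Y⟦n⟧) :
    hs A h' hb (hs A h ha f) = hs A h1' ha (hs A h1 hb f) ∨
    hs A h' hb (hs A h ha f) = - hs A h1' ha (hs A h1 hb f) := by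
  have hba := SetLike.mul_mem_graded hb ha
  have hab := SetLike.mul_mem_graded ha hb
  rw [hs_hs h h' rfl (by omega) ha hb hba, hs_hs h1 h1' rfl (by omega) hb ha hab]
  have h2 := hcomm j i b a hb ha
  rcases neg_one_pow_eq_or ℤ (j * i).natAbs with h3 | h3
  · left
    rw [h3, one_smul] at h2
    exact hs_congr _ _ _ _ h2 f
  · right
    rw [h3, neg_smul, one_smul] at h2
    rw [← hs_neg_left]
    exact hs_congr _ _ _ _ h2 f

theorem HomSub.hs_mem (S : HomSub A X Y) {n i m : ℤ} (h : n + i = m) {a : R} (ha : a ∈ 𝒜 i)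
    {f : X ⟶ Y⟦n⟧} (hf : f ∈ S.car n) : hs A h ha f ∈ S.car m := by
  subst h
  exact S.hsmul_mem i a ha n f hf

/-- adjoining one element to a graded submodule -/
def HomSub.adj (S : HomSub A X Y) {n : ℤ} (g : X ⟶ Y⟦n⟧) : HomSub A X Y where
  car m :=
    { carrier := {f | ∃ w ∈ S.car m, ∃ (i : ℤ) (h : n + i = m) (r : R) (hr : r ∈ 𝒜 i),
        f = w + hs A h hr g}
      zero_mem' := ⟨0, zero_mem _, m - n, by ring, 0, zero_mem _, by rw [hs_zero_left, add_zero]⟩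
      add_mem' := by
        rintro f f' ⟨w, hw, i, h, r, hr, rfl⟩ ⟨w', hw', i', h', r', hr', rfl⟩
        obtain rfl : i = i' := by omega
        refine ⟨w + w', add_mem hw hw', i, h, r + r', add_mem hr hr', ?_⟩
        rw [hs_add_left h hr hr']
        abel
      neg_mem' := by
        rintro f ⟨w, hw, i, h, r, hr, rfl⟩
        refine ⟨-w, neg_mem hw, i, h, -r, neg_mem hr, ?_⟩
        rw [hs_neg_left h hr]
        abel }
  hsmul_mem := by
    rintro j a ha m f ⟨w, hw, i, h, r, hr, rfl⟩
    refine ⟨hs A rfl ha w, S.hs_mem rfl ha hw, j + i, by omega, a * r,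
      SetLike.mul_mem_graded ha hr, ?_⟩
    rw [← hs_eq_hsmul, hs_add, hs_hs h rfl rfl]

theorem HomSub.le_adj (S : HomSub A X Y) {n : ℤ} (g : X ⟶ Y⟦n⟧) (m : ℤ) :
    S.car m ≤ (S.adj g).car m := fun f hf =>
  ⟨f, hf, m - n, by ring, 0, zero_mem _, by rw [hs_zero_left, add_zero]⟩

theorem HomSub.mem_adj (S : HomSub A X Y) {n : ℤ} (g : X ⟶ Y⟦n⟧) : g ∈ (S.adj g).car n :=
  ⟨0, zero_mem _, 0, add_zero n, 1, SetLike.one_mem_graded 𝒜, by rw [hs_one', zero_add]⟩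

/-- `S` agrees with everything after localizing at `p`. -/
def Dense (p : SpecR 𝒜) (S : HomSub A X Y) : Prop :=
  ∀ (n : ℤ) (f : X ⟶ Y⟦n⟧), ∃ (i : ℤ) (s : R) (m : ℤ) (h : n + i = m) (hs' : s ∈ 𝒜 i),
    s ∉ p.1.toIdeal ∧ hs A h hs' f ∈ S.car m

theorem Dense.of_adj (hcomm : IsGradedComm 𝒜) {ia : ℤ} {a : R} (ha : a ∈ 𝒜 ia)
    (hap : a ∈ p.1.toIdeal)
    (hsurj : ∀ (n : ℤ) (f : X ⟶ Y⟦n⟧), ∃ (i : ℤ) (t : R) (m k : ℤ) (h : n + i = m)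
      (h' : k + ia = m) (ht : t ∈ 𝒜 i) (g : X ⟶ Y⟦k⟧), t ∉ p.1.toIdeal ∧
      hs A h ht f = hs A h' ha g)
    (S : HomSub A X Y) {n : ℤ} (g : X ⟶ Y⟦n⟧) (hd : Dense p (S.adj g)) : Dense p S := by
  obtain ⟨it, t, m, k, h1, h2, ht, h, htp, e1⟩ := hsurj n g
  obtain ⟨j, s2, m2, h3, hs2, hs2p, w, hw, i2, h4, r, hr, e2⟩ := hd k h
  have hz : ∃ (z : R) (iz : ℤ) (hz : z ∈ 𝒜 iz) (mz : ℤ) (hm : n + iz = mz),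
      z ∉ p.1.toIdeal ∧ hs A hm hz g ∈ S.car mz := by
    have hst := SetLike.mul_mem_graded hs2 ht
    have har : a * r ∈ 𝒜 (j + it) := by
      have := SetLike.mul_mem_graded ha hr
      have h5 : ia + i2 = j + it := by omega
      rwa [h5] at this
    have hstp := mul_notMem p hs2 ht hs2p htp
    have harp : a * r ∈ p.1.toIdeal := mul_mem_right_hom hcomm _ ha hr hap
    have e3 : hs A (show n + (j + it) = m + j by omega) hst g = hs A rfl hs2 (hs A h2 ha h) := by
      rw [← e1, hs_hs h1 rfl rfl]
    have e4 : hs A (show m2 + ia = m + j by omega) ha (hs A h3 hs2 h) =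
        hs A (show m2 + ia = m + j by omega) ha w + hs A (show n + (j + it) = m + j by omega) har g := by
      rw [e2, hs_add, hs_hs h4 _ (by omega : ia + i2 = j + it) (by omega) hr ha har]
    have haw := S.hs_mem (show m2 + ia = m + j by omega) ha hw
    rcases hs_comm (A := A) hcomm h2 rfl h3 (show m2 + ia = m + j by omega) ha hs2 h with e | e
    · refine ⟨s2 * t + -(a * r), j + it, add_mem hst (neg_mem har), m + j, by omega, ?_, ?_⟩
      · intro hh
        exact hstp (by simpa using add_mem hh harp)
      · rw [hs_add_left _ hst (neg_mem har), hs_neg_left _ har, e3, e, e4]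
        simpa using haw
    · refine ⟨s2 * t + (a * r), j + it, add_mem hst (har), m + j, by omega, ?_, ?_⟩
      · intro hh
        exact hstp (by simpa using sub_mem hh harp)
      · rw [hs_add_left _ hst (har), e3, e, e4]
        simpa using haw
  obtain ⟨z, iz, hz, mz, hmz, hzp, hzg⟩ := hz
  intro n' f
  obtain ⟨i, s, m', h5, hs', hsp, w', hw', i3, h6, r', hr', e5⟩ := hd n' f
  refine ⟨iz + i, z * s, m' + iz, by omega, SetLike.mul_mem_graded hz hs', mul_notMem p hz hs' hzp hsp, ?_⟩
  rw [← hs_hs h5 rfl rfl _ hs' hz, e5, hs_add]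
  refine add_mem (S.hs_mem _ _ hw') ?_
  have h7 := S.hs_mem (show mz + i3 = m' + iz by omega) hr' hzg
  rcases hs_comm (A := A) hcomm h6 rfl hmz (show mz + i3 = m' + iz by omega) hr' hz g with e | e
  · rw [e]; exact h7
  · rw [e]; exact neg_mem h7

theorem Dense.of_finset (hcomm : IsGradedComm 𝒜) {ia : ℤ} {a : R} (ha : a ∈ 𝒜 ia)
    (hap : a ∈ p.1.toIdeal)
    (hsurj : ∀ (n : ℤ) (f : X ⟶ Y⟦n⟧), ∃ (i : ℤ) (t : R) (m k : ℤ) (h : n + i = m)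
      (h' : k + ia = m) (ht : t ∈ 𝒜 i) (g : X ⟶ Y⟦k⟧), t ∉ p.1.toIdeal ∧
      hs A h ht f = hs A h' ha g)
    (F : Finset ((n : ℤ) × (X ⟶ Y⟦n⟧))) : ∀ (S : HomSub A X Y),
    (∀ S' : HomSub A X Y, (∀ n, S.car n ≤ S'.car n) → (∀ g ∈ F, g.2 ∈ S'.car g.1) →
      ∀ n f, f ∈ S'.car n) → Dense p S := by
  classical
  induction F using Finset.induction_on with
  | empty =>
    intro S hS n f
    exact ⟨0, 1, n, add_zero n, SetLike.one_mem_graded 𝒜, one_notMem p,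
      hS S (fun _ => le_rfl) (by simp) _ _⟩
  | insert g F hg ih =>
    intro S hS
    refine Dense.of_adj hcomm ha hap hsurj S g.2 (ih _ fun S' hS' hF => hS S' ?_ ?_)
    · exact fun n => (S.le_adj g.2 n).trans (hS' n)
    · intro g' hg'
      rcases Finset.mem_insert.1 hg' with rfl | hg'
      · exact hS' _ (S.mem_adj g'.2)
      · exact hF _ hg'

theorem LV.nakayama (hcomm : IsGradedComm 𝒜) {ia : ℤ} {a : R} (ha : a ∈ 𝒜 ia)
    (hap : a ∈ p.1.toIdeal)
    (hsurj : ∀ (n : ℤ) (f : X ⟶ Y⟦n⟧), ∃ (i : ℤ) (t : R) (m k : ℤ) (h : n + i = m)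
      (h' : k + ia = m) (ht : t ∈ 𝒜 i) (g : X ⟶ Y⟦k⟧), t ∉ p.1.toIdeal ∧
      hs A h ht f = hs A h' ha g)
    (hfg : FGHom A X Y) : LV A p X Y := by
  obtain ⟨F, hF⟩ := hfg
  let S : HomSub A X Y :=
    { car := fun _ => ⊥
      hsmul_mem := by
        intro i a ha n f hf
        rw [AddSubgroup.mem_bot] at hf ⊢
        rw [hf, ← hs_eq_hsmul, hs_zero] }
  have := Dense.of_finset hcomm ha hap hsurj F S fun S' _ h n f => hF S' h n f
  intro n f
  obtain ⟨i, s, m, h, hs', hp, e⟩ := this n f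
  exact ⟨i, s, hs', hp, (hs_eq_zero_iff h hs' f).1 ((AddSubgroup.mem_bot).1 e)⟩

theorem koszul_surj {ia : ℤ} {a : R} {ha : a ∈ 𝒜 ia} {K : T} (hK : IsKoszul A a ha Y K)
    (hL : LV A p X K) (n : ℤ) (f : X ⟶ Y⟦n⟧) : ∃ (i : ℤ) (t : R) (m k : ℤ) (h : n + i = m)
      (h' : k + ia = m) (ht : t ∈ 𝒜 i) (g : X ⟶ Y⟦k⟧), t ∉ p.1.toIdeal ∧
      hs A h ht f = hs A h' ha g := by
  obtain ⟨w, d, h⟩ := hK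
  let f' : X ⟶ Y⟦ia⟧⟦n - ia⟧ := f ≫ (shiftFunctorAdd' T ia (n - ia) n (by ring)).hom.app Y
  have hf' : f = f' ≫ (shiftFunctorAdd' T ia (n - ia) n (by ring)).inv.app Y := by simp [f']
  obtain ⟨j, t, ht, htp, e⟩ := hL (n - ia) (f' ≫ w⟦n - ia⟧')
  have e1 : hs A (show n - ia + j = n + j - ia by ring) ht f' ≫ w⟦n + j - ia⟧' = 0 := by
    unfold hs
    have h2 := (shiftFunctorAdd' T (n - ia) j (n + j - ia) (by ring)).inv.naturality w
    simp only [Category.assoc] at e ⊢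
    rw [← h2]
    rw [A.act_natural] at e
    rw [Functor.comp_map, reassoc_of% e, zero_comp]
  have key : ∃ g : X ⟶ Y⟦n + j - ia⟧, hs A (show n - ia + j = n + j - ia by ring) ht f' =
    g ≫ (A.act ia a ha Y)⟦n + j - ia⟧' := exists_lift_shift h _ _ e1
  obtain ⟨g, hg⟩ := key
  have e2 : hs A rfl ht f = hs A (show n - ia + j = n + j - ia by ring) ht f' ≫
      (shiftFunctorAdd' T ia (n + j - ia) (n + j) (by ring)).inv.app Y := by
    have h1 := shiftFunctorAdd'_assoc_inv_app (C := T) ia (n - ia) j n (n + j - ia) (n + j)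
      (by ring) (by ring) (by ring) Y
    conv_lhs => rw [hf']
    unfold hs
    simp only [Category.assoc]
    rw [← h1, reassoc_of% (A.act_natural j t ht
      ((shiftFunctorAdd' T ia (n - ia) n (by ring)).inv.app Y))]
  have e3 : (shiftComm Y ia (n + j - ia)).hom ≫
      (shiftFunctorAdd' T (n + j - ia) ia (n + j) (by ring)).inv.app Y =
      (shiftFunctorAdd' T ia (n + j - ia) (n + j) (by ring)).inv.app Y := by
    simp [shiftComm, shiftFunctorComm_eq T ia (n + j - ia) (n + j) (by ring)]
  have e4 : hs A rfl ht f = hs A (show n + j - ia + ia = n + j by ring) ha g ∨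
      hs A rfl ht f = - hs A (show n + j - ia + ia = n + j by ring) ha g := by
    rw [e2, hg]
    unfold hs
    rw [A.act_shift]
    rcases neg_one_pow_eq_or ℤ (ia * (n + j - ia)).natAbs with h3 | h3
    · left
      rw [h3, one_smul]
      simp only [Category.assoc]
      rw [e3]
    · right
      rw [h3, neg_smul, one_smul]
      simp only [Category.assoc, Preadditive.neg_comp, Preadditive.comp_neg, neg_neg]
      rw [e3]
  rcases e4 with e4 | e4
  · exact ⟨j, t, n + j, n + j - ia, rfl, by ring, ht, g, htp, e4⟩
  · exact ⟨j, t, n + j, n + j - ia, rfl, by ring, ht, -g, htp, by rw [e4, hs_neg]⟩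

theorem IsKoszul.kill_of (hcomm : IsGradedComm 𝒜) (hT : NoetherianT A) {ia : ℤ} {a : R}
    {ha : a ∈ 𝒜 ia} {K : T} (hK : IsKoszul A a ha Y K) (hap : a ∈ p.1.toIdeal)
    (hY : IsCompactObj T Y) (h : Kill A p (𝟙 K)) : Kill A p (𝟙 Y) := by
  refine LV.kill (LV.nakayama hcomm ha hap (koszul_surj hK ?_) (hT Y hY)) _
  intro n f
  refine Kill.of_id_right ?_ f
  simpa using h.shift n

theorem IsKoszulSeq.kill_of (hcomm : IsGradedComm 𝒜) (hT : NoetherianT A) {K : T}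
    {l : List ((i : ℤ) × {a : R // a ∈ 𝒜 i})} (hK : IsKoszulSeq A X l K)
    (hl : ∀ s ∈ l, (s.2 : R) ∈ p.1.toIdeal) (hX : IsCompactObj T X) (h : Kill A p (𝟙 K)) :
    Kill A p (𝟙 X) := by
  induction hK with
  | nil => exact h
  | cons Y K i a l h1 h2 ih =>
    refine ih (fun s hs => hl s (List.mem_cons_of_mem _ hs)) ?_
    exact h2.kill_of hcomm hT (hl _ List.mem_cons_self) (h1.compact hX) h

end Nakayama

end BIK

namespace BIK

section LFun

variable {R : Type u} [Ring R] {𝒜 : ℤ → AddSubgroup R} [GradedRing 𝒜]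
variable {T : Type u'} [Category.{v} T] [HasZeroObject T] [Preadditive T] [HasShift T ℤ]
  [∀ n : ℤ, (CategoryTheory.shiftFunctor T n).Additive] [Pretriangulated T]
  [HasCoproducts.{v} T]
variable {A : CenterAction 𝒜 T} {p : SpecR 𝒜}

theorem exists_gens (hnoeth : IsNoetherianRing R) (p : SpecR 𝒜) :
    ∃ l : List ((i : ℤ) × {a : R // a ∈ 𝒜 i}), (∀ s ∈ l, (s.2 : R) ∈ p.1.toIdeal) ∧
      ∀ r : SpecR 𝒜, ¬ p.1.toIdeal ≤ r.1.toIdeal → ∃ s ∈ l, (s.2 : R) ∉ r.1.toIdeal := by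
  classical
  obtain ⟨S, hS⟩ := (isNoetherianRing_iff_ideal_fg R).1 hnoeth p.1.toIdeal
  have hSp : ∀ x ∈ S, x ∈ p.1.toIdeal := fun x hx => by
    rw [← hS]; exact Ideal.subset_span hx
  refine ⟨S.toList.flatMap fun x => (DirectSum.decompose 𝒜 x).support.toList.map fun i =>
    ⟨i, DirectSum.decompose 𝒜 x i⟩, ?_, ?_⟩
  · intro s hs
    simp only [List.mem_flatMap, List.mem_map, Finset.mem_toList] at hs
    obtain ⟨x, hx, i, hi, rfl⟩ := hs
    exact p.1.isHomogeneous i (hSp x hx)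
  · intro r hr
    by_contra hcon
    push Not at hcon
    apply hr
    rw [← hS]
    refine Ideal.span_le.2 fun x hx => ?_
    rw [← DirectSum.sum_support_decompose 𝒜 x]
    refine sum_mem fun i hi => ?_
    refine hcon ⟨i, DirectSum.decompose 𝒜 x i⟩ ?_
    simp only [List.mem_flatMap, List.mem_map, Finset.mem_toList]
    exact ⟨x, hx, i, hi, rfl⟩

theorem specClosed_Zset (p : SpecR 𝒜) : SpecClosed (Zset p) := fun _ _ h1 h2 h3 =>
  h1 (h2.trans h3)

theorem specClosed_Vp (p : SpecR 𝒜) : SpecClosed (Vp p) := fun _ _ h1 h2 => le_trans h1 h2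

theorem Kill.mono {r : SpecR 𝒜} (hr : r.1.toIdeal ≤ p.1.toIdeal) {X Y : T} {f : X ⟶ Y}
    (h : Kill A p f) : Kill A r f := by
  obtain ⟨i, s, hs, hp, e⟩ := h
  exact ⟨i, s, hs, fun h => hp (hr h), e⟩

theorem mem_TVset_of_kill {V : Set (SpecR 𝒜)} {X : T} (h : ∀ r, r ∉ V → Kill A r (𝟙 X)) :
    X ∈ TVset T A V := by
  rw [mem_TVset_iff]
  intro C hC r hr n f
  refine Kill.of_id_right ?_ f
  simpa using (h r hr).shift n

theorem mem_TVset_Zset {X : T} (h : Kill A p (𝟙 X)) : X ∈ TVset T A (Zset p) :=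
  mem_TVset_of_kill fun r hr => h.mono (not_not.1 hr)

theorem kill_of_mem_TVset_Zset {X : T} (hX : IsCompactObj T X) (h : X ∈ TVset T A (Zset p)) :
    Kill A p (𝟙 X) :=
  (mem_TVset_iff.1 h X hX p (fun h => h le_rfl)).kill _

theorem noMap_of_shift {K F : T} (h : ∀ (m : ℤ) (g : K⟦m⟧ ⟶ F), g = 0) : NoMap K F := by
  intro n f
  apply (shiftFunctor T (-n)).map_injective
  rw [Functor.map_zero]
  have := h (-n) (f⟦-n⟧' ≫ (shiftShiftNeg F n).hom)
  exact (cancel_mono (shiftShiftNeg F n).hom).1 (this.trans zero_comp.symm)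

theorem NoMap.shift_right {K F : T} (h : NoMap K F) (m : ℤ) : NoMap K (F⟦m⟧) := fun n f => by
  have := h (m + n) (f ≫ (shiftFunctorAdd' T m n (m + n) rfl).inv.app F)
  exact (cancel_mono ((shiftFunctorAdd' T m n (m + n) rfl).inv.app F)).1
    (this.trans zero_comp.symm)

theorem NoMap.hom_zero {K F : T} (h : NoMap K F) (f : K ⟶ F) : f = 0 := by
  have := h 0 (f ≫ (shiftFunctorZero T ℤ).inv.app F)
  exact (cancel_mono ((shiftFunctorZero T ℤ).inv.app F)).1 (this.trans zero_comp.symm)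

variable (B : BIKData A)

theorem L_hom_zero {V : Set (SpecR 𝒜)} (hV : SpecClosed V) {K X : T} (hK : K ∈ TVset T A V)
    (f : K ⟶ (B.Lf V).obj X) : f = 0 := by
  have h1 := (B.η V).naturality f
  have h2 : IsIso ((B.η V).app ((B.Lf V).obj X)) := by
    rw [← B.Lη_eq V hV]; exact B.Lη_iso V hV X
  have h3 : (B.η V).app K = 0 := ((B.kerL V hV K).2 hK).eq_of_tgt _ _
  rw [h3, zero_comp] at h1
  exact (cancel_mono ((B.η V).app ((B.Lf V).obj X))).1 (h1.trans zero_comp.symm)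

theorem L_noMap (hcomm : IsGradedComm 𝒜) {V : Set (SpecR 𝒜)} (hV : SpecClosed V) {K X : T}
    (hK : K ∈ TVset T A V) : NoMap K ((B.Lf V).obj X) :=
  noMap_of_shift fun m g => L_hom_zero B hV ((isLocalizing_TVset hcomm V).shift_mem K hK m) g

theorem L_isZero_of_eta {V : Set (SpecR 𝒜)} (hV : SpecClosed V) {E : T}
    (h : (B.η V).app E = 0) : IsZero ((B.Lf V).obj E) := by
  have h2 : IsIso ((B.η V).app ((B.Lf V).obj E)) := by
    rw [← B.Lη_eq V hV]; exact B.Lη_iso V hV E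
  have key : ∀ g : (B.Lf V).obj E ⟶ (B.Lf V).obj E,
      g ≫ (B.η V).app ((B.Lf V).obj E) = (B.Lf V).map 0 := by
    intro g
    have h1 := (B.η V).naturality g
    refine h1.trans ?_
    rw [← B.Lη_eq V hV, ← Functor.map_comp]
    congr 1
    erw [h, zero_comp]
  rw [IsZero.iff_id_eq_zero]
  exact (cancel_mono ((B.η V).app ((B.Lf V).obj E))).1 ((key _).trans (key _).symm)

theorem act_L_isIso (hcomm : IsGradedComm 𝒜) (X : T) {i : ℤ} {s : R} (hs : s ∈ 𝒜 i)
    (hp : s ∉ p.1.toIdeal) : IsIso (A.act i s hs ((B.Lf (Zset p)).obj X)) := by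
  obtain ⟨K, hK⟩ := koszul_exists A s hs ((B.Lf (Zset p)).obj X)
  exact hK.isIso_of_noMap (L_noMap B hcomm (specClosed_Zset p) (mem_TVset_Zset (hK.kill_id hp)))

theorem ΓP_isZero (hcomm : IsGradedComm 𝒜) {X : T} (h : IsZero ((B.Lf (Zset p)).obj X)) :
    IsZero ((B.ΓP p).obj X) := by
  have hV := specClosed_Vp p
  have h1 := (B.kerL _ hV _).2 ((isLocalizing_TVset (A := A) hcomm (Vp p)).zero_mem _ h)
  exact Triangle.isZero₁_of_isZero₂₃ _ (B.tri _ hV ((B.Lf (Zset p)).obj X)) h h1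

theorem ΓP_isZero_of_kill (hcomm : IsGradedComm 𝒜) {X : T} (h : Kill A p (𝟙 X)) :
    IsZero ((B.ΓP p).obj X) :=
  ΓP_isZero B hcomm ((B.kerL _ (specClosed_Zset p) _).2 (mem_TVset_Zset h))

theorem eta_lift {E : T} (hE : E ∈ TVset T A (Vp p)) :
    ∃ k : E ⟶ (B.ΓP p).obj E,
      (B.η (Zset p)).app E = k ≫ (B.γ (Vp p)).app ((B.Lf (Zset p)).obj E) := by
  have hV := specClosed_Vp p
  exact Triangle.coyoneda_exact₂ _ (B.tri _ hV ((B.Lf (Zset p)).obj E)) _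
    (L_hom_zero B hV hE _)

theorem koszulSeq_mem_TV {l : List ((i : ℤ) × {a : R // a ∈ 𝒜 i})}
    (hl : ∀ r : SpecR 𝒜, ¬ p.1.toIdeal ≤ r.1.toIdeal → ∃ s ∈ l, (s.2 : R) ∉ r.1.toIdeal)
    {C K : T} (hK : IsKoszulSeq A C l K) : K ∈ TVset T A (Vp p) :=
  mem_TVset_of_kill fun r hr => by
    obtain ⟨s, hs, hsr⟩ := hl r hr
    exact hK.kill_id hs hsr

theorem ΓP_mem_Loc (hlg : B.LocalGlobal) (q : SpecR 𝒜) (X : T) :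
    (B.ΓP q).obj X ∈ Loc T {X} := by
  rw [hlg X]
  exact subset_Loc _ ⟨q, rfl⟩

theorem act_ΓP_isIso (hcomm : IsGradedComm 𝒜) (hlg : B.LocalGlobal) {E : T}
    (hE : E ∈ TVset T A (Vp p)) {i : ℤ} {s : R} (hs : s ∈ 𝒜 i)
    (hp : s ∉ p.1.toIdeal) : IsIso (A.act i s hs ((B.ΓP p).obj E)) := by
  have hV := specClosed_Vp p
  obtain ⟨K, hK⟩ := koszul_exists A s hs ((B.ΓP p).obj E)
  have hF : (B.ΓP p).obj E ∈ TVset T A (Vp p) :=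
    Loc_subset (isLocalizing_TVset hcomm _) (by simpa using hE) (ΓP_mem_Loc B hlg p E)
  have hKV := hK.mem_localizing (isLocalizing_TVset hcomm _) hF
  refine hK.isIso_of_noMap fun m f => ?_
  have h1 := hK.noMap (act_L_isIso B hcomm E hs hp) m
    (f ≫ ((B.γ (Vp p)).app ((B.Lf (Zset p)).obj E))⟦m⟧')
  have htr := inv_rot_of_distTriang _ (B.tri _ hV ((B.Lf (Zset p)).obj E))
  obtain ⟨g, hg⟩ := exists_lift_shift htr m f h1
  have hg0 : g = 0 := ((L_noMap B hcomm hV hKV).shift_right (-1)) m g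
  rw [hg, hg0]
  exact zero_comp

/-- the localizing subcategory of objects with no `p`-local maps from `C // p` -/
def Sset (A : CenterAction 𝒜 T) (p : SpecR 𝒜) (l : List ((i : ℤ) × {a : R // a ∈ 𝒜 i})) :
    Set T :=
  {X | ∀ x : {x : T × T // IsCompactObj T x.1 ∧ IsKoszulSeq A x.1 l x.2},
    X ∈ {X : T | LV A p x.1.2 X}}

theorem isLocalizing_Sset (hcomm : IsGradedComm 𝒜) (l : List ((i : ℤ) × {a : R // a ∈ 𝒜 i})) :
    IsLocalizing T (Sset A p l) :=
  isLocalizing_forall fun x => isLocalizing_LV hcomm (x.2.2.compact x.2.1)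

theorem ΓPImage_subset_Sset (hcomm : IsGradedComm 𝒜) (hnoeth : IsNoetherianRing R)
    (hT : NoetherianT A) (hst : Stratified B) {l : List ((i : ℤ) × {a : R // a ∈ 𝒜 i})}
    (hl : ∀ r : SpecR 𝒜, ¬ p.1.toIdeal ≤ r.1.toIdeal → ∃ s ∈ l, (s.2 : R) ∉ r.1.toIdeal)
    {q : SpecR 𝒜} (hqp : q ≠ p) : B.ΓPImage q ⊆ Sset A p l := by
  rcases hst.2 q with h0 | hmin
  · intro X hX
    exact (isLocalizing_Sset hcomm l).zero_mem X (h0 X hX)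
  obtain ⟨hloc, ⟨X₀, ⟨Y₀, ⟨e₀⟩⟩, hX₀⟩, hmin⟩ := hmin
  obtain ⟨lq, hlq1, hlq2⟩ := exists_gens hnoeth q
  have hex : ∃ (C' E : T), IsCompactObj T C' ∧ IsKoszulSeq A C' lq E ∧
      ¬ IsZero ((B.ΓP q).obj E) := by
    by_contra hcon
    push Not at hcon
    apply hX₀
    refine IsZero.of_iso ?_ e₀
    refine ΓP_isZero B hcomm ((B.kerL _ (specClosed_Zset q) _).2 ?_)
    rw [mem_TVset_iff]
    intro C hC r hr n f
    refine Kill.mono (not_not.1 hr) (Kill.of_id_left ?_ f)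
    obtain ⟨E, hE⟩ := koszulSeq_exists A C lq
    refine hE.kill_of hcomm hT hlq1 hC ?_
    refine kill_of_mem_TVset_Zset (hE.compact hC) ((B.kerL _ (specClosed_Zset q) _).1 ?_)
    refine L_isZero_of_eta B (specClosed_Zset q) ?_
    obtain ⟨k, hk⟩ := eta_lift B (koszulSeq_mem_TV hlq2 hE)
    rw [hk, (hcon C E hC hE).eq_of_tgt k 0]
    exact zero_comp
  obtain ⟨C', E, hC', hE, hne⟩ := hex
  have hEV := koszulSeq_mem_TV hlq2 hE
  have hFV : (B.ΓP q).obj E ∈ TVset T A (Vp q) :=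
    Loc_subset (isLocalizing_TVset hcomm _) (by simpa using hEV) (ΓP_mem_Loc B hst.1 q E)
  have hFS : (B.ΓP q).obj E ∈ Sset A p l := by
    rintro ⟨⟨C, K⟩, hC, hK⟩
    change LV A p K _
    by_cases hqp' : q.1.toIdeal ≤ p.1.toIdeal
    · have hpq : ¬ p.1.toIdeal ≤ q.1.toIdeal := fun h =>
        hqp (Subtype.ext (HomogeneousIdeal.toIdeal_injective (le_antisymm hqp' h)))
      obtain ⟨s, hs, hsq⟩ := hl q hpq
      have := hK.noMap hs (act_ΓP_isIso B hcomm hst.1 hEV s.2.2 hsq)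
      intro n f
      rw [this n f]
      exact Kill.zero
    · exact mem_TVset_iff.1 hFV K (hK.compact hC) p hqp'
  rcases hmin _ (hloc.inter (isLocalizing_Sset (A := A) (p := p) hcomm l))
    Set.inter_subset_left with h | h
  · exact absurd (h _ ⟨⟨E, ⟨Iso.refl _⟩⟩, hFS⟩) hne
  · rw [← h]
    exact Set.inter_subset_right

theorem kill_of_ΓP_isZero (hcomm : IsGradedComm 𝒜) (hnoeth : IsNoetherianRing R)
    (hT : NoetherianT A) (hst : Stratified B) {C : T} (hC : IsCompactObj T C)
    (h : IsZero ((B.ΓP p).obj C)) : Kill A p (𝟙 C) := by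
  obtain ⟨l, hl1, hl2⟩ := exists_gens hnoeth p
  have hCS : C ∈ Sset A p l := by
    have h1 : C ∈ Loc T {Y | ∃ q : SpecR 𝒜, Y = (B.ΓP q).obj C} := by
      rw [← hst.1 C]; exact subset_Loc _ rfl
    refine Loc_subset (isLocalizing_Sset hcomm l) ?_ h1
    rintro _ ⟨q, rfl⟩
    by_cases hq : q = p
    · subst hq
      exact (isLocalizing_Sset hcomm l).zero_mem _ h
    · exact ΓPImage_subset_Sset B hcomm hnoeth hT hst hl2 hq ⟨C, ⟨Iso.refl _⟩⟩
  obtain ⟨K, hK⟩ := koszulSeq_exists A C l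
  refine hK.kill_of hcomm hT hl1 hC ?_
  have h1 : LV A p K C := hCS ⟨⟨C, K⟩, hC, hK⟩
  have hKC : IsLocalizing T {X : T | LV A p K X} := isLocalizing_LV hcomm (hK.compact hC)
  have h2 : ∀ {X : T} {l : List ((i : ℤ) × {a : R // a ∈ 𝒜 i})} {S : Set T},
      IsLocalizing T S → IsKoszulSeq A C l X → C ∈ S → X ∈ S := by
    intro X l S hS hX hCS
    induction hX with
    | nil => exact hCS
    | cons Y K i a l h1 h2 ih => exact h2.mem_localizing hS ih
  exact (show LV A p K K from h2 hKC hK h1).kill _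

theorem bigSupp_eq (hcomm : IsGradedComm 𝒜) (hnoeth : IsNoetherianRing R)
    (hT : NoetherianT A) (hst : Stratified B) {C D : T} (hC : IsCompactObj T C)
    (hD : IsCompactObj T D) : bigSuppHom A C D = B.suppObj C ∩ B.suppObj D := by
  ext p
  constructor
  · intro hp
    constructor
    · intro h
      exact hp ((locVanishes_iff C D).2 fun n f =>
        Kill.of_id_left (kill_of_ΓP_isZero B hcomm hnoeth hT hst hC h) f)
    · intro h
      refine hp ((locVanishes_iff C D).2 fun n f => Kill.of_id_right ?_ f)
      simpa using (kill_of_ΓP_isZero B hcomm hnoeth hT hst hD h).shift n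
  · rintro ⟨hpC, hpD⟩ hv
    rw [locVanishes_iff] at hv
    rcases hst.2 p with h0 | ⟨hloc, -, hmin⟩
    · exact hpD (h0 _ ⟨D, ⟨Iso.refl _⟩⟩)
    have hLC : IsLocalizing T {X : T | LV A p C X} := isLocalizing_LV hcomm hC
    have hsub : B.ΓPImage p ⊆ {X : T | LV A p C X} := by
      rcases hmin _ (hloc.inter hLC) Set.inter_subset_left with h | h
      · refine absurd (h _ ⟨⟨D, ⟨Iso.refl _⟩⟩, ?_⟩) hpD
        exact Loc_subset hLC (by simpa using hv) (ΓP_mem_Loc B hst.1 p D)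
      · rw [← h]
        exact Set.inter_subset_right
    apply hpC
    apply ΓP_isZero_of_kill B hcomm
    obtain ⟨l, hl1, hl2⟩ := exists_gens hnoeth p
    obtain ⟨K, hK⟩ := koszulSeq_exists A C l
    refine hK.kill_of hcomm hT hl1 hC ?_
    refine kill_of_mem_TVset_Zset (hK.compact hC) ((B.kerL _ (specClosed_Zset p) _).1 ?_)
    refine L_isZero_of_eta B (specClosed_Zset p) ?_
    obtain ⟨k, hk⟩ := eta_lift B (koszulSeq_mem_TV hl2 hK)
    have h1 : LV A p K ((B.ΓP p).obj K) := hK.LV_left (hsub ⟨K, ⟨Iso.refl _⟩⟩)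
    have h2 : Kill A p ((B.η (Zset p)).app K) := by
      rw [hk]
      exact (h1.kill k).comp_right _
    obtain ⟨i, s, hs, hsp, e⟩ := h2
    have := act_L_isIso B hcomm K hs hsp
    exact (cancel_mono (A.act i s hs ((B.Lf (Zset p)).obj K))).1 (e.trans zero_comp.symm)

end LFun

end BIK

namespace BIK

section RingPart

variable {R : Type u} [Ring R] {𝒜 : ℤ → AddSubgroup R} [GradedRing 𝒜]

theorem mem_sup_span {J : HomogeneousIdeal 𝒜} {i k : ℤ} {a x : R} (ha : a ∈ 𝒜 i) (hx : x ∈ 𝒜 k)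
    (h : x ∈ J.toIdeal ⊔ Ideal.span {a}) :
    ∃ w ∈ J.toIdeal, ∃ r, w ∈ 𝒜 k ∧ r ∈ 𝒜 (k - i) ∧ x = w + r * a := by
  obtain ⟨w, hw, y, hy, e⟩ := Submodule.mem_sup.1 h
  obtain ⟨r, rfl⟩ := Ideal.mem_span_singleton'.1 hy
  refine ⟨DirectSum.decompose 𝒜 w k, J.isHomogeneous k hw, DirectSum.decompose 𝒜 r (k - i),
    SetLike.coe_mem _, SetLike.coe_mem _, ?_⟩
  have h1 := DirectSum.coe_decompose_mul_add_of_right_mem 𝒜 (i := k - i) (a := r) ha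
  rw [sub_add_cancel] at h1
  rw [← h1, ← AddSubgroup.coe_add, ← DirectSum.add_apply, ← DirectSum.decompose_add, e,
    DirectSum.decompose_of_mem_same 𝒜 hx]

theorem eventually_mem (hcomm : IsGradedComm 𝒜) (hnoeth : IsNoetherianRing R)
    (J : HomogeneousIdeal 𝒜)
    (hJ : ∀ P : SpecR 𝒜, J.toIdeal ≤ P.1.toIdeal → ∀ i : ℤ, 1 ≤ i → ∀ x ∈ 𝒜 i, x ∈ P.1.toIdeal) :
    ∃ N : ℤ, ∀ i ≥ N, ∀ x ∈ 𝒜 i, x ∈ J.toIdeal := by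
  have hwf : WellFounded (fun I I' : Ideal R => I > I') := IsWellFounded.wf
  induction hI : J.toIdeal using hwf.induction generalizing J with
  | _ I ih =>
  subst hI
  by_cases hP : IsHomPrime 𝒜 J
  · exact ⟨1, fun i hi x hx => hJ ⟨J, hP⟩ le_rfl i hi x hx⟩
  by_cases htop : J.toIdeal = ⊤
  · exact ⟨0, fun i hi x hx => by rw [htop]; trivial⟩
  have hex : ∃ (i j : ℤ) (a b : R), a ∈ 𝒜 i ∧ b ∈ 𝒜 j ∧ a * b ∈ J.toIdeal ∧
      a ∉ J.toIdeal ∧ b ∉ J.toIdeal := by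
    by_contra hcon
    push Not at hcon
    refine hP ⟨htop, fun {i j a b} ha hb hab => ?_⟩
    by_contra h
    push Not at h
    exact h.2 (hcon i j a b ha hb hab h.1)
  obtain ⟨i, j, a, b, ha, hb, hab, haJ, hbJ⟩ := hex
  have step : ∀ (i : ℤ) (a : R), a ∈ 𝒜 i → a ∉ J.toIdeal →
      ∃ N : ℤ, ∀ k ≥ N, ∀ x ∈ 𝒜 k, x ∈ J.toIdeal ⊔ Ideal.span {a} := by
    intro i a ha haJ
    have hh : (J.toIdeal ⊔ Ideal.span {a}).IsHomogeneous 𝒜 := by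
      refine Ideal.IsHomogeneous.sup J.isHomogeneous (Ideal.homogeneous_span 𝒜 _ ?_)
      rintro x rfl
      exact ⟨i, ha⟩
    refine ih _ ?_ ⟨_, hh⟩ ?_ rfl
    · refine lt_of_le_of_ne le_sup_left fun h => haJ ?_
      rw [h]
      exact Ideal.mem_sup_right (Ideal.mem_span_singleton_self a)
    · intro P hP
      exact hJ P (le_trans le_sup_left hP)
  obtain ⟨N1, hN1⟩ := step i a ha haJ
  obtain ⟨N2, hN2⟩ := step j b hb hbJ
  refine ⟨max N1 (N2 + i), fun k hk x hx => ?_⟩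
  obtain ⟨w, hw, r, hwk, hr, rfl⟩ := mem_sup_span ha hx (hN1 k (by omega) x hx)
  refine add_mem hw ?_
  obtain ⟨w', hw', r', hwk', hr', rfl⟩ := mem_sup_span hb hr (hN2 (k - i) (by omega) r hr)
  rw [add_mul, mul_assoc]
  refine add_mem (mul_mem_right_hom hcomm _ hwk' ha hw') (Ideal.mul_mem_left _ _ ?_)
  rw [hcomm j i b a hb ha]
  exact zsmul_mem hab _

end RingPart

section Part2

variable {R : Type u} [Ring R] {𝒜 : ℤ → AddSubgroup R} [GradedRing 𝒜]
variable {T : Type u'} [Category.{v} T] [HasZeroObject T] [Preadditive T] [HasShift T ℤ]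
  [∀ n : ℤ, (CategoryTheory.shiftFunctor T n).Additive] [Pretriangulated T]
  [HasCoproducts.{v} T]
variable {A : CenterAction 𝒜 T} {p : SpecR 𝒜}

/-- `a` of degree `i` kills `f` -/
def KZ (A : CenterAction 𝒜 T) {X Y : T} (f : X ⟶ Y) (i : ℤ) (a : R) : Prop :=
  ∀ ha : a ∈ 𝒜 i, f ≫ A.act i a ha Y = 0

theorem KZ.zero {X Y : T} (f : X ⟶ Y) (i : ℤ) : KZ A f i 0 := fun ha => by
  rw [act_zero, comp_zero]

/-- annihilator ideal of a morphism -/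
def annIdeal (A : CenterAction 𝒜 T) {X Y : T} (f : X ⟶ Y) : Ideal R where
  carrier := {r | ∀ i, KZ A f i (DirectSum.decompose 𝒜 r i)}
  zero_mem' := fun i => by
    rw [DirectSum.decompose_zero, DirectSum.zero_apply, AddSubgroup.coe_zero]
    exact KZ.zero f i
  add_mem' := by
    intro a b ha hb i
    rw [DirectSum.decompose_add, DirectSum.add_apply, AddSubgroup.coe_add]
    intro h
    rw [A.act_add i _ _ (SetLike.coe_mem _) (SetLike.coe_mem _), Preadditive.comp_add,
      ha i, hb i, add_zero]
  smul_mem' := by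
    intro x r hr
    rw [smul_eq_mul]
    induction x using DirectSum.Decomposition.inductionOn 𝒜 with
    | zero =>
      intro i
      rw [zero_mul, DirectSum.decompose_zero, DirectSum.zero_apply, AddSubgroup.coe_zero]
      exact KZ.zero f i
    | @homogeneous j m =>
      intro i
      have h1 := DirectSum.coe_decompose_mul_add_of_left_mem 𝒜 (j := i - j) (b := r) m.2
      rw [add_sub_cancel] at h1
      rw [h1]
      have h2 := act_mul_eq_zero (A := A) m.2 (SetLike.coe_mem _) (hr (i - j) (SetLike.coe_mem _))
      intro h
      rw [act_congr A (show i = j + (i - j) by ring) rfl _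
        (SetLike.mul_mem_graded m.2 (SetLike.coe_mem _)), ← Category.assoc, h2, zero_comp]
    | add m m' h h' =>
      intro i
      rw [add_mul, DirectSum.decompose_add, DirectSum.add_apply, AddSubgroup.coe_add]
      intro h3
      rw [A.act_add i _ _ (SetLike.coe_mem _) (SetLike.coe_mem _), Preadditive.comp_add,
        h i, h' i, add_zero]

theorem mem_annIdeal {X Y : T} {f : X ⟶ Y} {i : ℤ} {a : R} (ha : a ∈ 𝒜 i) :
    a ∈ annIdeal A f ↔ f ≫ A.act i a ha Y = 0 := by
  constructor
  · intro h
    have := h i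
    rw [DirectSum.decompose_of_mem_same 𝒜 ha] at this
    exact this ha
  · intro h j
    by_cases hj : i = j
    · subst hj
      rw [DirectSum.decompose_of_mem_same 𝒜 ha]
      exact fun _ => h
    · rw [DirectSum.decompose_of_mem_ne 𝒜 ha hj]
      exact KZ.zero f j

theorem annIdeal_homogeneous {X Y : T} (f : X ⟶ Y) : (annIdeal A f).IsHomogeneous 𝒜 := by
  intro i r hr
  exact (mem_annIdeal (SetLike.coe_mem _)).2 (hr i _)

theorem pow_notMem (p : SpecR 𝒜) {i : ℤ} {s : R} (hs : s ∈ 𝒜 i) (hp : s ∉ p.1.toIdeal) (k : ℕ) :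
    s ^ k ∉ p.1.toIdeal := by
  induction k with
  | zero => simpa using one_notMem p
  | succ k ih =>
    rw [pow_succ]
    exact mul_notMem p (SetLike.pow_mem_graded k hs) hs ih hp

theorem exists_kill_bound (hcomm : IsGradedComm 𝒜) (hnoeth : IsNoetherianRing R)
    {C D : T} (hsupp : bigSuppHom A D C ⊆ bigSuppHom A C D)
    (N : ℤ) (hN : ∀ n ≥ N, ∀ f : C ⟶ D⟦n⟧, f = 0) {m : ℤ} (f : D ⟶ C⟦m⟧) :
    ∃ N' : ℤ, ∀ i ≥ N', ∀ (a : R) (ha : a ∈ 𝒜 i), f ≫ A.act i a ha _ = 0 := by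
  obtain ⟨N', hN'⟩ := eventually_mem hcomm hnoeth ⟨annIdeal A f, annIdeal_homogeneous f⟩ (by
    intro p hp i hi s hs
    by_contra hsp
    have h1 : p ∈ bigSuppHom A D C := by
      intro hv
      obtain ⟨j, t, ht, htp, e⟩ := (locVanishes_iff D C).1 hv m f
      exact htp (hp ((mem_annIdeal ht).2 e))
    apply hsupp h1
    rw [locVanishes_iff]
    intro n g
    have hpow := SetLike.pow_mem_graded (N - n).toNat hs
    refine ⟨_, s ^ (N - n).toNat, hpow, pow_notMem p hs hsp _, ?_⟩
    refine (hs_eq_zero_iff rfl hpow g).1 (hN _ ?_ _)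
    rw [nsmul_eq_mul]
    have : ((N - n).toNat : ℤ) * 1 ≤ ((N - n).toNat : ℤ) * i :=
      mul_le_mul_of_nonneg_left hi (by positivity)
    omega)
  exact ⟨N', fun i hi a ha => (mem_annIdeal ha).1 (hN' i hi a ha)⟩

theorem compact_biprod {C D : T} [HasBinaryBiproduct C D] (hC : IsCompactObj T C)
    (hD : IsCompactObj T D) : IsCompactObj T (C ⊞ D) := by
  have h := inv_rot_of_distTriang _ (binaryBiproductTriangle_distinguished C D)
  exact IsCompactObj.cone h (hD.shift (-1)) hC

theorem vanish_symm (hcomm : IsGradedComm 𝒜) (hnoeth : IsNoetherianRing R)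
    (hT : NoetherianT A) {C D : T} (hC : IsCompactObj T C) (hD : IsCompactObj T D)
    (hsupp : bigSuppHom A D C ⊆ bigSuppHom A C D)
    (h : ∃ N : ℤ, ∀ n ≥ N, ∀ f : C ⟶ D⟦n⟧, f = 0) :
    ∃ N : ℤ, ∀ n ≥ N, ∀ f : D ⟶ C⟦n⟧, f = 0 := by
  obtain ⟨N, hN⟩ := h
  obtain ⟨F, hF⟩ := hT (C ⊞ D) (compact_biprod hC hD)
  choose b hb using fun (m : ℤ) (f : D ⟶ C⟦m⟧) =>
    exists_kill_bound (A := A) hcomm hnoeth hsupp N hN f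
  obtain ⟨M, hM⟩ := Finset.exists_le (F.image fun g : (n : ℤ) × (C ⊞ D ⟶ (C ⊞ D)⟦n⟧) =>
    g.1 + b g.1 (biprod.inr ≫ g.2 ≫ (biprod.fst : C ⊞ D ⟶ C)⟦g.1⟧'))
  have hφ : ∀ {n i m : ℤ} (hm : n + i = m) {a : R} (ha : a ∈ 𝒜 i) (f : C ⊞ D ⟶ (C ⊞ D)⟦n⟧),
      biprod.inr ≫ hs A hm ha f ≫ (biprod.fst : C ⊞ D ⟶ C)⟦m⟧' =
      hs A hm ha (biprod.inr ≫ f ≫ (biprod.fst : C ⊞ D ⟶ C)⟦n⟧') := by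
    intro n i m hm a ha f
    unfold hs
    have h2 := (shiftFunctorAdd' T n i m hm).inv.naturality (biprod.fst : C ⊞ D ⟶ C)
    simp only [Category.assoc]
    rw [← h2, reassoc_of% (A.act_natural i a ha ((biprod.fst : C ⊞ D ⟶ C)⟦n⟧'))]
    rfl
  let S : HomSub A (C ⊞ D) (C ⊞ D) :=
    { car := fun n =>
        { carrier := {f | ∀ (i : ℤ) (a : R) (ha : a ∈ 𝒜 i) (m : ℤ) (hm : n + i = m), m ≥ M →
            hs A hm ha (biprod.inr ≫ f ≫ (biprod.fst : C ⊞ D ⟶ C)⟦n⟧') = 0}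
          zero_mem' := by
            intro i a ha m hm _
            rw [zero_comp, comp_zero, hs_zero]
          add_mem' := by
            intro f g hf hg i a ha m hm hmM
            rw [Preadditive.add_comp, Preadditive.comp_add, hs_add, hf i a ha m hm hmM,
              hg i a ha m hm hmM, add_zero]
          neg_mem' := by
            intro f hf i a ha m hm hmM
            rw [Preadditive.neg_comp, Preadditive.comp_neg, hs_neg, hf i a ha m hm hmM, neg_zero] }
      hsmul_mem := by
        intro j c hc n f hf i a ha m hm hmM
        rw [← hs_eq_hsmul, hφ, hs_hs rfl hm rfl (by omega) hc ha (SetLike.mul_mem_graded ha hc)]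
        exact hf _ _ _ _ _ hmM }
  have hall := hF S (by
    rintro g hg i a ha m hm hmM
    rw [hs_eq_zero_iff]
    refine hb _ _ i ?_ a ha
    have := hM _ (Finset.mem_image_of_mem _ hg)
    omega)
  refine ⟨M, fun n hn f => ?_⟩
  have h1 := hall n (biprod.snd ≫ f ≫ (biprod.inl : C ⟶ C ⊞ D)⟦n⟧') 0 1
    (SetLike.one_mem_graded 𝒜) n (add_zero n) hn
  rw [hs_one'] at h1
  simpa [← Functor.map_comp] using h1

end Part2

end BIK

open BIK in
/-- Corollary: if `T` is noetherian and stratified by `R` then for compact objects `C`, `D`,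
`supp_R Hom*(C,D) = supp_R C ∩ supp_R D`; if moreover `R` is nonnegatively graded, then
`Homⁿ(C,D)` vanishes for `n ≫ 0` iff `Homⁿ(D,C)` does. -/
theorem statement_6
{R : Type u} [Ring R] (𝒜 : ℤ → AddSubgroup R) [GradedRing 𝒜]
    (hcomm : IsGradedComm 𝒜) (hnoeth : IsNoetherianRing R)
    {T : Type u'} [Category.{v} T] [HasZeroObject T] [Preadditive T] [HasShift T ℤ]
    [∀ n : ℤ, (CategoryTheory.shiftFunctor T n).Additive] [Pretriangulated T]
    [HasCoproducts.{v} T]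
    (hgen : CompactlyGen T)
    (A : CenterAction 𝒜 T) (B : BIKData A)
    (hT : NoetherianT A) (hst : Stratified B)
    (C D : T) (hC : IsCompactObj T C) (hD : IsCompactObj T D) :
    bigSuppHom A C D = B.suppObj C ∩ B.suppObj D ∧
    ((∀ i : ℤ, i < 0 → 𝒜 i = ⊥) →
      ((∃ N : ℤ, ∀ n ≥ N, ∀ f : C ⟶ D⟦n⟧, f = 0) ↔
       (∃ N : ℤ, ∀ n ≥ N, ∀ f : D ⟶ C⟦n⟧, f = 0))) := by
  refine ⟨bigSupp_eq B hcomm hnoeth hT hst hC hD, fun _ => ?_⟩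
  have h : bigSuppHom A C D = bigSuppHom A D C := by
    rw [bigSupp_eq B hcomm hnoeth hT hst hC hD, bigSupp_eq B hcomm hnoeth hT hst hD hC,
      Set.inter_comm]
  exact ⟨vanish_symm hcomm hnoeth hT hC hD h.ge, vanish_symm hcomm hnoeth hT hD hC h.le⟩
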